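/- Let ϖ₂(τ) = (η(τ)η(3τ))⁴ / (η(2τ)η(6τ))². Then ϖ₂((3+√−15)/6) = Γ(1/15)·Γ(2/15)·Γ(4/15)·Γ(8/15) / (10√3·π³), where √−15 denotes i√15; in particular this value is real and positive. -/

import Mathlib

/-- The Dedekind eta function `η(τ) = e^{πiτ/12} ∏_{n≥1} (1 - e^{2πinτ})`. -/
noncomputable def dedekindEta (τ : ℂ) : ℂ :=
  Complex.exp (Real.pi * Complex.I * τ / 12) *
    ∏' n : ℕ, (1 - Complex.exp (2 * Real.pi * Complex.I * ((n : ℂ) + 1) * τ))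

/-- `ϖ₂(τ) = (η(τ)η(3τ))⁴ / (η(2τ)η(6τ))²`. -/
noncomputable def varpi₂ (τ : ℂ) : ℂ :=
  (dedekindEta τ * dedekindEta (3 * τ)) ^ 4 / (dedekindEta (2 * τ) * dedekindEta (6 * τ)) ^ 2

section

open Real MeasureTheory Set Filter Topology
open scoped UpperHalfPlane

theorem integral_one_add_sq_rpow_neg {s : ℝ} (hs : 1 / 2 < s) :
    ∫ t : ℝ, (1 + t ^ 2) ^ (-s) = √π * Gamma (s - 1 / 2) / Gamma s := by
  have hs0 : 0 < s := by linarith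
  set F : ℝ → ℝ → ℝ := fun t u ↦ u ^ (s - 1) * exp (-(u * (1 + t ^ 2))) with hF
  have hFnn : ∀ u ∈ Ioi (0 : ℝ), ∀ t, 0 ≤ F t u := fun u hu t ↦ by
    have := rpow_nonneg (le_of_lt hu) (s - 1)
    positivity
  have inner_t : ∀ u ∈ Ioi (0 : ℝ), ∫ t, F t u = √π * (exp (-u) * u ^ ((s - 1 / 2) - 1)) := by
    intro u hu
    have : ∀ t, F t u = (u ^ (s - 1) * exp (-u)) * exp (-u * t ^ 2) := fun t ↦ by
      simp only [hF, mul_assoc, ← Real.exp_add]; ring_nf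
    simp_rw [this]
    have hu' : u ^ (s - 1 / 2 - 1) = u ^ (s - 1) / √u := by
      rw [sqrt_eq_rpow, ← rpow_sub hu]; ring_nf
    rw [integral_const_mul, integral_gaussian, sqrt_div pi_pos.le, hu']
    ring
  have hint : Integrable (Function.uncurry fun u t ↦ F t u)
      ((volume.restrict (Ioi 0)).prod volume) := by
    rw [integrable_prod_iff]
    · constructor
      · filter_upwards [ae_restrict_mem measurableSet_Ioi] with u hu
        have : (fun t ↦ F t u) = fun t ↦ (u ^ (s - 1) * exp (-u)) * exp (-u * t ^ 2) := by
          ext t; simp only [hF, mul_assoc, ← Real.exp_add]; ring_nf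
        simpa [Function.uncurry, this] using (integrable_exp_neg_mul_sq hu).const_mul _
      · refine Integrable.congr (f := fun u ↦ √π * (exp (-u) * u ^ ((s - 1 / 2) - 1))) ?_ ?_
        · exact (GammaIntegral_convergent (by linarith)).const_mul _
        · filter_upwards [ae_restrict_mem measurableSet_Ioi] with u hu
          rw [← inner_t u hu]
          exact integral_congr_ae (.of_forall fun t ↦ (norm_of_nonneg (hFnn u hu t)).symm)
    · refine Measurable.aestronglyMeasurable ?_
      simp only [hF, Function.uncurry_def]
      fun_prop
  have key := integral_integral_swap (f := fun u t ↦ F t u) hint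
  have h1 : ∫ u in Ioi (0 : ℝ), ∫ t, F t u = √π * Gamma (s - 1 / 2) := by
    rw [setIntegral_congr_fun measurableSet_Ioi inner_t, integral_const_mul,
      Gamma_eq_integral (by linarith)]
  have h2 : ∀ t, ∫ u in Ioi (0 : ℝ), F t u = Gamma s * (1 + t ^ 2) ^ (-s) := fun t ↦ by
    have ht : (0 : ℝ) < 1 + t ^ 2 := by positivity
    have := integral_rpow_mul_exp_neg_mul_Ioi hs0 ht
    simp only [hF]
    rw [show (fun u : ℝ ↦ u ^ (s - 1) * exp (-(u * (1 + t ^ 2)))) =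
      fun u ↦ u ^ (s - 1) * exp (-((1 + t ^ 2) * u)) by ext; ring_nf, this, one_div,
      inv_rpow ht.le, rpow_neg ht.le]
    ring
  rw [h1] at key
  simp_rw [h2] at key
  rw [integral_const_mul] at key
  rw [key, mul_div_assoc, mul_comm, div_mul_cancel₀ _ (Gamma_pos_of_pos hs0).ne']

theorem hasDerivAt_Gamma_quotient :
    HasDerivAt (fun s ↦ √π * Gamma (s - 1 / 2) / Gamma s) (-2 * π * log 2) 1 := by
  have h1 : HasDerivAt (fun s : ℝ ↦ Gamma (s - 1 / 2))
      (-√π * (eulerMascheroniConstant + 2 * log 2)) 1 := by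
    have : HasDerivAt Gamma (-√π * (eulerMascheroniConstant + 2 * log 2)) ((1 : ℝ) - 1 / 2) := by
      convert hasDerivAt_Gamma_one_half using 1; norm_num
    simpa using HasDerivAt.comp_sub_const 1 (1 / 2) this
  have h2 : HasDerivAt Gamma (-eulerMascheroniConstant) 1 := hasDerivAt_Gamma_one
  refine ((h1.const_mul √π).div h2 (by simp)).congr_deriv ?_
  rw [show (1 : ℝ) - 1 / 2 = 1 / 2 by norm_num, Gamma_one_half_eq, Gamma_one]
  have := mul_self_sqrt pi_pos.le
  linear_combination (-2 * log 2) * this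

theorem ofReal_tsum_rpow_eq_riemannZeta {s : ℝ} (hs : 1 < s) :
    ((∑' n : ℕ, ((n : ℝ) + 1) ^ (-s) : ℝ) : ℂ) = riemannZeta s := by
  rw [zeta_eq_tsum_one_div_nat_add_one_cpow (by simpa), Complex.ofReal_tsum]
  refine tsum_congr fun n ↦ ?_
  rw [Complex.ofReal_cpow (by positivity)]
  push_cast
  rw [Complex.cpow_neg, one_div]

theorem tendsto_tsum_rpow_sub_one_div :
    Tendsto (fun s : ℝ ↦ (∑' n : ℕ, ((n : ℝ) + 1) ^ (-s)) - 1 / (s - 1)) (𝓝[>] 1)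
      (𝓝 eulerMascheroniConstant) := by
  have := (Complex.continuous_re.tendsto _).comp
    ZetaAsymptotics.tendsto_riemannZeta_sub_one_div_nhds_right
  refine this.congr' ?_
  filter_upwards [self_mem_nhdsWithin] with s hs
  rw [Function.comp_apply, ← ofReal_tsum_rpow_eq_riemannZeta hs]
  norm_cast

/-- The squared modulus `|m z + n|²`. -/
noncomputable def latticeNormSq (z : ℍ) (m n : ℝ) : ℝ := (m * z.re + n) ^ 2 + (m * z.im) ^ 2

theorem latticeNormSq_eq (z : ℍ) (m n : ℝ) : latticeNormSq z m n = ‖(m : ℂ) * z + n‖ ^ 2 := by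
  rw [← Complex.normSq_eq_norm_sq, Complex.normSq_apply, latticeNormSq]
  simp
  ring

theorem latticeNormSq_nonneg (z : ℍ) (m n : ℝ) : 0 ≤ latticeNormSq z m n := by
  unfold latticeNormSq; positivity

theorem latticeNormSq_pos (z : ℍ) {m : ℝ} (hm : m ≠ 0) (n : ℝ) : 0 < latticeNormSq z m n := by
  have := z.im_pos
  unfold latticeNormSq; positivity

theorem latticeNormSq_rpow (z : ℍ) (m n s : ℝ) :
    latticeNormSq z m n ^ (-s) = ‖(m : ℂ) * z + n‖ ^ (-(2 * s)) := by
  rw [latticeNormSq_eq, ← rpow_natCast, ← rpow_mul (norm_nonneg _)]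
  congr 1; push_cast; ring

theorem summable_latticeNormSq_rpow (z : ℍ) {s : ℝ} (hs : 1 < s) :
    Summable fun p : ℤ × ℤ ↦ latticeNormSq z p.1 p.2 ^ (-s) := by
  rw [← (finTwoArrowEquiv ℤ).summable_iff]
  refine Summable.of_nonneg_of_le (fun v ↦ rpow_nonneg (latticeNormSq_nonneg ..) _) (fun v ↦ ?_)
    ((EisensteinSeries.summable_one_div_norm_rpow (k := 2 * s) (by linarith)).mul_left
      (EisensteinSeries.r z ^ (-(2 * s))))
  rw [Function.comp_apply, latticeNormSq_rpow]
  simpa using EisensteinSeries.summand_bound z (k := 2 * s) (by linarith) v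

/-- The difference between a term of the lattice sum and its average over a unit interval. -/
noncomputable def latticeDiff (z : ℍ) (s m n : ℝ) : ℝ :=
  latticeNormSq z m n ^ (-s) - ∫ t in (0 : ℝ)..1, latticeNormSq z m (n + t) ^ (-s)

theorem hasDerivAt_latticeNormSq_rpow (z : ℍ) {m : ℝ} (hm : m ≠ 0) (n s t : ℝ) :
    HasDerivAt (fun t ↦ latticeNormSq z m (n + t) ^ (-s))
      (2 * (m * z.re + (n + t)) * (-s) * latticeNormSq z m (n + t) ^ (-s - 1)) t := by
  have h : HasDerivAt (fun t ↦ latticeNormSq z m (n + t)) (2 * (m * z.re + (n + t))) t := by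
    have h0 : HasDerivAt (fun t ↦ m * z.re + (n + t)) 1 t :=
      ((hasDerivAt_id t).const_add n).const_add _
    simpa [latticeNormSq] using (h0.pow 2).add_const ((m * z.im) ^ 2)
  exact h.rpow_const (Or.inl (latticeNormSq_pos z hm _).ne')

theorem continuous_latticeNormSq_rpow (z : ℍ) {m : ℝ} (hm : m ≠ 0) (n s : ℝ) :
    Continuous (fun t ↦ latticeNormSq z m (n + t) ^ (-s)) :=
  continuous_iff_continuousAt.mpr fun t ↦ (hasDerivAt_latticeNormSq_rpow z hm n s t).continuousAt

theorem abs_latticeDiff_le (z : ℍ) {s m n C : ℝ} (hm : m ≠ 0)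
    (hC : ∀ t ∈ Icc (0 : ℝ) 1, 2 * |s| * latticeNormSq z m (n + t) ^ (-s - 1 / 2) ≤ C) :
    |latticeDiff z s m n| ≤ C := by
  have hcont := continuous_latticeNormSq_rpow z hm n s
  have hd : ∀ t ∈ Icc (0 : ℝ) 1, ‖2 * (m * z.re + (n + t)) * (-s) *
      latticeNormSq z m (n + t) ^ (-s - 1)‖ ≤ C := by
    intro t ht
    refine le_trans ?_ (hC t ht)
    have hp := latticeNormSq_pos z hm (n + t)
    have h1 : |m * z.re + (n + t)| ≤ latticeNormSq z m (n + t) ^ (1 / 2 : ℝ) := by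
      rw [← sqrt_eq_rpow]
      apply abs_le_sqrt
      unfold latticeNormSq
      nlinarith [sq_nonneg (m * z.im)]
    have h2 : latticeNormSq z m (n + t) ^ (-s - 1 / 2) =
        latticeNormSq z m (n + t) ^ (1 / 2 : ℝ) * latticeNormSq z m (n + t) ^ (-s - 1) := by
      rw [← rpow_add hp]; ring_nf
    have h3 := rpow_nonneg hp.le (-s - 1)
    rw [norm_eq_abs, abs_mul, abs_mul, abs_mul, abs_neg, abs_of_nonneg h3, abs_two, h2]
    nlinarith [mul_le_mul_of_nonneg_right h1 (mul_nonneg (abs_nonneg s) h3)]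
  have hlip : ∀ t ∈ Icc (0 : ℝ) 1,
      ‖latticeNormSq z m n ^ (-s) - latticeNormSq z m (n + t) ^ (-s)‖ ≤ C := by
    intro t ht
    have h0 : (0 : ℝ) ∈ Icc (0 : ℝ) 1 := by simp
    have := Convex.norm_image_sub_le_of_norm_hasDerivWithin_le (s := Icc (0 : ℝ) 1)
      (fun u hu ↦ (hasDerivAt_latticeNormSq_rpow z hm n s u).hasDerivWithinAt) hd
      (convex_Icc 0 1) ht h0
    have hC0 : 0 ≤ C := (norm_nonneg _).trans (hd 0 h0)
    simp only [add_zero, zero_sub, norm_neg] at this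
    refine this.trans ?_
    rw [norm_of_nonneg ht.1]
    nlinarith [ht.1, ht.2]
  have : latticeDiff z s m n = ∫ t in (0 : ℝ)..1,
      (latticeNormSq z m n ^ (-s) - latticeNormSq z m (n + t) ^ (-s)) := by
    rw [intervalIntegral.integral_sub (by simp) (hcont.intervalIntegrable _ _)]
    simp [latticeDiff]
  rw [this]
  have := intervalIntegral.norm_integral_le_of_norm_le_const (a := (0 : ℝ)) (b := 1) (C := C)
    (f := fun t ↦ latticeNormSq z m n ^ (-s) - latticeNormSq z m (n + t) ^ (-s))
    (fun t ht ↦ hlip t (by rw [uIoc_of_le zero_le_one] at ht; exact ⟨ht.1.le, ht.2⟩))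
  simpa using this

theorem exists_le_latticeNormSq (z : ℍ) : ∃ c > 0, ∀ (m : ℕ) (n : ℤ), ∀ t ∈ Icc (0 : ℝ) 1,
    (c * ‖![(m + 1 : ℤ), n]‖) ^ 2 ≤ latticeNormSq z (m + 1) (n + t) := by
  have hy := z.im_pos
  refine ⟨EisensteinSeries.r z / (1 + 1 / z.im), div_pos (EisensteinSeries.r_pos z) (by positivity),
    fun m n t ht ↦ ?_⟩
  rw [latticeNormSq_eq]
  have h1 : EisensteinSeries.r z * ‖![(m + 1 : ℤ), n]‖ ≤ ‖((m + 1 : ℝ) : ℂ) * z + n‖ := by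
    have := EisensteinSeries.r_mul_max_le z (x := ![(m + 1 : ℤ), n])
      (fun h ↦ by have := congrFun h 0; simp at this; omega)
    simpa using this
  set w : ℂ := ((m + 1 : ℝ) : ℂ) * z + ((n + t : ℝ) : ℂ) with hw
  have h2 : z.im ≤ ‖w‖ := by
    have : w.im = (m + 1) * z.im := by simp [hw]
    refine le_trans ?_ ((le_abs_self _).trans (Complex.abs_im_le_norm w))
    rw [this]
    nlinarith [(Nat.cast_nonneg m : (0 : ℝ) ≤ m)]
  have h3 : ‖((m + 1 : ℝ) : ℂ) * z + n‖ ≤ ‖w‖ + 1 := by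
    have : ((m + 1 : ℝ) : ℂ) * z + n = w - (t : ℂ) := by rw [hw]; push_cast; ring
    rw [this]
    refine (norm_sub_le _ _).trans ?_
    rw [Complex.norm_real, norm_of_nonneg ht.1]
    linarith [ht.2]
  have h4 : 1 ≤ ‖w‖ * (1 / z.im) := by
    rw [mul_one_div, le_div_iff₀ hy]; linarith
  have h5 : EisensteinSeries.r z / (1 + 1 / z.im) * ‖![(m + 1 : ℤ), n]‖ ≤ ‖w‖ := by
    rw [div_mul_eq_mul_div, div_le_iff₀ (by positivity)]
    linarith
  have h6 := (EisensteinSeries.r_pos z).le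
  gcongr

theorem exists_summable_bound_latticeDiff (z : ℍ) : ∃ b : ℕ × ℤ → ℝ, Summable b ∧
    ∀ s ∈ Icc (1 : ℝ) 2, ∀ p : ℕ × ℤ, |latticeDiff z s (p.1 + 1) p.2| ≤ b p := by
  obtain ⟨c, hc, h⟩ := exists_le_latticeNormSq z
  set K : ℝ := max (c ^ (-3 : ℝ)) (c ^ (-5 : ℝ)) with hK
  refine ⟨fun p ↦ 4 * K * ‖![(p.1 + 1 : ℤ), p.2]‖ ^ (-3 : ℝ), ?_, fun s hs p ↦ ?_⟩
  · refine Summable.mul_left _ ?_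
    have := EisensteinSeries.summable_one_div_norm_rpow (k := 3) (by norm_num)
    refine this.comp_injective (i := fun p : ℕ × ℤ ↦ ![(p.1 + 1 : ℤ), p.2]) ?_
    intro p q hpq
    have h0 := congrFun hpq 0
    have h1 := congrFun hpq 1
    simp at h0 h1
    exact Prod.ext h0 h1
  · refine abs_latticeDiff_le z (by positivity) fun t ht ↦ ?_
    have hN : 1 ≤ ‖![(p.1 + 1 : ℤ), p.2]‖ := by
      refine le_trans ?_ (EisensteinSeries.abs_le_left_of_norm _ _)
      push_cast
      rw [abs_of_nonneg (by positivity)]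
      linarith [(Nat.cast_nonneg p.1 : (0 : ℝ) ≤ p.1)]
    set N := ‖![(p.1 + 1 : ℤ), p.2]‖
    have hN0 : 0 < N := by linarith
    have h1 : latticeNormSq z (p.1 + 1) (p.2 + t) ^ (-s - 1 / 2) ≤ ((c * N) ^ 2) ^ (-s - 1 / 2) :=
      rpow_le_rpow_of_nonpos (by positivity) (h p.1 p.2 t ht) (by linarith [hs.1])
    have h2 : ((c * N) ^ 2) ^ (-s - 1 / 2) = c ^ (-2 * s - 1) * N ^ (-2 * s - 1) := by
      rw [← rpow_natCast, ← rpow_mul (by positivity), ← mul_rpow hc.le hN0.le]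
      congr 1; push_cast; ring
    have h3 : N ^ (-2 * s - 1) ≤ N ^ (-3 : ℝ) :=
      rpow_le_rpow_of_exponent_le hN (by linarith [hs.1])
    have h4 : c ^ (-2 * s - 1) ≤ K := by
      rcases le_total 1 c with h1c | h1c
      · exact le_max_of_le_left (rpow_le_rpow_of_exponent_le h1c (by linarith [hs.1]))
      · exact le_max_of_le_right (rpow_le_rpow_of_exponent_ge hc h1c (by linarith [hs.2]))
    have h5 : 2 * |s| ≤ 4 := by rw [abs_of_nonneg (by linarith [hs.1])]; linarith [hs.2]
    rw [h2] at h1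
    calc 2 * |s| * latticeNormSq z (p.1 + 1) (p.2 + t) ^ (-s - 1 / 2)
        ≤ 4 * (K * N ^ (-3 : ℝ)) := by
          refine mul_le_mul h5 (h1.trans ?_) (rpow_nonneg (latticeNormSq_nonneg ..) _) (by norm_num)
          exact mul_le_mul h4 h3 (rpow_nonneg hN0.le _) ((rpow_pos_of_pos hc _).le.trans h4)
      _ = _ := by ring

theorem tendsto_latticeDiff (z : ℍ) {m : ℝ} (hm : m ≠ 0) (n : ℝ) :
    Tendsto (fun s ↦ latticeDiff z s m n) (𝓝[>] 1) (𝓝 (latticeDiff z 1 m n)) := by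
  refine Tendsto.mono_left ?_ nhdsWithin_le_nhds
  refine Continuous.tendsto (f := fun s ↦ latticeDiff z s m n) ?_ 1
  have h : Continuous fun q : ℝ × ℝ ↦ latticeNormSq z m (n + q.2) ^ (-q.1) := by
    refine Continuous.rpow ?_ (by fun_prop) fun q ↦ Or.inl (latticeNormSq_pos z hm _).ne'
    unfold latticeNormSq; fun_prop
  unfold latticeDiff
  refine Continuous.sub ?_ ?_
  · exact Continuous.rpow continuous_const (by fun_prop) fun q ↦
      Or.inl (latticeNormSq_pos z hm _).ne'
  · exact intervalIntegral.continuous_parametric_intervalIntegral_of_continuous' h 0 1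

theorem tendsto_tsum_latticeDiff (z : ℍ) :
    Tendsto (fun s ↦ ∑' p : ℕ × ℤ, latticeDiff z s (p.1 + 1) p.2) (𝓝[>] 1)
      (𝓝 (∑' p : ℕ × ℤ, latticeDiff z 1 (p.1 + 1) p.2)) := by
  obtain ⟨b, hb, h⟩ := exists_summable_bound_latticeDiff z
  refine tendsto_tsum_of_dominated_convergence hb
    (fun p ↦ tendsto_latticeDiff z (by positivity) _) ?_
  filter_upwards [Ioo_mem_nhdsGT (show (1 : ℝ) < 2 by norm_num)] with s hs p
  exact h s ⟨hs.1.le, hs.2.le⟩ p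

theorem summable_latticeDiff (z : ℍ) {s : ℝ} (hs : s ∈ Icc (1 : ℝ) 2) :
    Summable fun p : ℕ × ℤ ↦ latticeDiff z s (p.1 + 1) p.2 := by
  obtain ⟨b, hb, h⟩ := exists_summable_bound_latticeDiff z
  exact hb.of_norm_bounded fun p ↦ h s hs p

theorem latticeNormSq_eq_scale (z : ℍ) {m : ℝ} (hm : 0 < m) (t s : ℝ) :
    latticeNormSq z m t ^ (-s) =
      (m * z.im) ^ (-2 * s) * (1 + ((m * z.re + t) / (m * z.im)) ^ 2) ^ (-s) := by
  have hy : 0 < m * z.im := mul_pos hm z.im_pos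
  have : latticeNormSq z m t =
      (m * z.im) ^ 2 * (1 + ((m * z.re + t) / (m * z.im)) ^ 2) := by
    unfold latticeNormSq; field_simp; ring
  rw [this, mul_rpow (by positivity) (by positivity), ← rpow_natCast, ← rpow_mul hy.le]
  congr 2; push_cast; ring

theorem integrable_latticeNormSq_rpow (z : ℍ) {m s : ℝ} (hm : 0 < m) (hs : 1 / 2 < s) :
    Integrable fun t ↦ latticeNormSq z m t ^ (-s) := by
  have hy : m * z.im ≠ 0 := (mul_pos hm z.im_pos).ne'
  simp_rw [latticeNormSq_eq_scale z hm]
  refine Integrable.const_mul ?_ _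
  have h : Integrable fun t : ℝ ↦ (1 + t ^ 2) ^ (-s) := by
    have := integrable_rpow_neg_one_add_norm_sq (E := ℝ) (μ := volume) (r := 2 * s)
      (by simp; linarith)
    simpa [neg_div] using this
  exact (h.comp_div hy).comp_add_left (m * z.re)

theorem integral_latticeNormSq_rpow (z : ℍ) {m : ℝ} (hm : 0 < m) (s : ℝ) :
    ∫ t, latticeNormSq z m t ^ (-s) =
      (m * z.im) ^ (1 - 2 * s) * ∫ t : ℝ, (1 + t ^ 2) ^ (-s) := by
  have hy : 0 < m * z.im := mul_pos hm z.im_pos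
  simp_rw [latticeNormSq_eq_scale z hm]
  rw [integral_const_mul,
    integral_add_left_eq_self (fun t ↦ (1 + (t / (m * z.im)) ^ 2) ^ (-s)) (m * z.re),
    Measure.integral_comp_div (fun t ↦ (1 + t ^ 2) ^ (-s)), abs_of_pos hy, smul_eq_mul, ← mul_assoc,
    show 1 - 2 * s = -2 * s + 1 by ring, rpow_add_one hy.ne']

theorem hasSum_integral_latticeNormSq_rpow (z : ℍ) {m s : ℝ} (hm : 0 < m) (hs : 1 / 2 < s) :
    HasSum (fun n : ℤ ↦ ∫ t in (0 : ℝ)..1, latticeNormSq z m (n + t) ^ (-s))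
      ((m * z.im) ^ (1 - 2 * s) * ∫ t : ℝ, (1 + t ^ 2) ^ (-s)) := by
  rw [← integral_latticeNormSq_rpow z hm]
  simpa only [add_comm] using
    (integrable_latticeNormSq_rpow z hm hs).hasSum_intervalIntegral_comp_add_int

theorem summable_latticeNormSq_rpow_int (z : ℍ) {s : ℝ} (hs : s ∈ Icc (1 : ℝ) 2) (m : ℕ) :
    Summable fun n : ℤ ↦ latticeNormSq z (m + 1) n ^ (-s) := by
  have h := ((summable_latticeDiff z hs).prod_factor m).add
    (hasSum_integral_latticeNormSq_rpow z (m := m + 1) (s := s) (by positivity)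
      (by linarith [hs.1])).summable
  simpa [latticeDiff] using h

theorem tsum_latticeDiff_int (z : ℍ) {s : ℝ} (hs : s ∈ Icc (1 : ℝ) 2) (m : ℕ) :
    ∑' n : ℤ, latticeDiff z s (m + 1) n = ∑' n : ℤ, latticeNormSq z (m + 1) n ^ (-s) -
      ((m + 1) * z.im) ^ (1 - 2 * s) * ∫ t : ℝ, (1 + t ^ 2) ^ (-s) := by
  have hI := hasSum_integral_latticeNormSq_rpow z (m := m + 1) (s := s) (by positivity)
    (by linarith [hs.1])
  unfold latticeDiff
  rw [(summable_latticeNormSq_rpow_int z hs m).tsum_sub hI.summable, hI.tsum_eq]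

theorem tsum_int_eq_of_summable {f : ℤ → ℝ} (hf : Summable f) :
    ∑' n, f n = f 0 + ∑' n : ℕ, (f (-(n + 1 : ℤ)) + f (n + 1 : ℤ)) := by
  have hA : Summable fun n : ℕ ↦ f (n + 1 : ℤ) :=
    hf.comp_injective (i := fun n : ℕ ↦ (n + 1 : ℤ)) fun a b h ↦ by simpa using h
  have hB : Summable fun n : ℕ ↦ f (-(n + 1 : ℤ)) :=
    hf.comp_injective (i := fun n : ℕ ↦ -(n + 1 : ℤ)) fun a b h ↦ by simpa using h
  rw [hB.tsum_add hA, tsum_of_add_one_of_neg_add_one hA hB]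
  ring

theorem im_pi_mul_cot_eq_tsum (w : ℍ) (hS : Summable fun n : ℤ ↦ (1 / ((w : ℂ) + n)).im) :
    ((π : ℂ) * Complex.cot (π * w)).im = ∑' n : ℤ, (1 / ((w : ℂ) + n)).im := by
  have hwi : (w : ℂ) ∈ Complex.integerComplement := UpperHalfPlane.coe_mem_integerComplement w
  have hc : (π : ℂ) * Complex.cot (π * w) - 1 / (w : ℂ) = ∑' n : ℕ, cotTerm (w : ℂ) n :=
    cot_series_rep' hwi
  have hsum : Summable fun n : ℕ ↦ cotTerm (w : ℂ) n := summable_cotTerm hwi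
  rw [tsum_int_eq_of_summable hS, ← sub_eq_iff_eq_add', Int.cast_zero, add_zero, ← Complex.sub_im,
    hc, Complex.im_tsum hsum]
  refine tsum_congr fun n ↦ ?_
  rw [cotTerm, Complex.add_im]
  push_cast
  rw [← sub_eq_add_neg, sub_eq_add_neg, neg_add]

theorem im_pi_mul_cot_eq_tsum_pow (w : ℍ) : ((π : ℂ) * Complex.cot (π * w)).im =
    -π * (1 + 2 * ∑' k : ℕ, (Complex.exp (2 * π * Complex.I * w) ^ (k + 1)).re) := by
  have hq : ‖Complex.exp (2 * π * Complex.I * w)‖ < 1 := UpperHalfPlane.norm_exp_two_pi_I_lt_one w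
  have hgeo := summable_geometric_of_norm_lt_one hq
  rw [pi_mul_cot_pi_q_exp, hgeo.tsum_eq_zero_add,
    ← Complex.re_tsum ((summable_nat_add_iff 1).mpr hgeo)]
  generalize ∑' k : ℕ, Complex.exp (2 * π * Complex.I * w) ^ (k + 1) = t
  simp
  ring

theorem tsum_inv_latticeNormSq (z : ℍ) (m : ℕ) :
    ∑' n : ℤ, latticeNormSq z (m + 1) n ^ (-1 : ℝ) =
      π / ((m + 1) * z.im) *
        (1 + 2 * ∑' k : ℕ, ((Complex.exp (2 * π * Complex.I * z) ^ ((m + 1) * (k + 1))).re)) := by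
  have hy : 0 < (m + 1) * z.im := mul_pos (by positivity) z.im_pos
  obtain ⟨w, hwc⟩ : ∃ w : ℍ, (w : ℂ) = (m + 1) * z :=
    ⟨⟨(m + 1) * z, by simpa using hy⟩, rfl⟩
  have him : ∀ n : ℤ, (1 / ((w : ℂ) + n)).im =
      -((m + 1) * z.im) * latticeNormSq z (m + 1) n ^ (-1 : ℝ) := fun n ↦ by
    rw [rpow_neg_one, one_div, Complex.inv_im, Complex.normSq_apply, latticeNormSq]
    simp [hwc]
    ring
  have hS := summable_latticeNormSq_rpow_int z (s := 1) (by simp) m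
  have h1 := im_pi_mul_cot_eq_tsum w (by simp_rw [him]; exact hS.mul_left _)
  simp_rw [him] at h1
  rw [tsum_mul_left, im_pi_mul_cot_eq_tsum_pow] at h1
  have hqe : ∀ k : ℕ, Complex.exp (2 * π * Complex.I * w) ^ (k + 1) =
      Complex.exp (2 * π * Complex.I * z) ^ ((m + 1) * (k + 1)) := fun k ↦ by
    rw [pow_mul, ← Complex.exp_nat_mul _ (m + 1), hwc]; push_cast; ring_nf
  simp_rw [hqe] at h1
  generalize (∑' k : ℕ, ((Complex.exp (2 * π * Complex.I * z) ^ ((m + 1) * (k + 1))).re)) = A at *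
  field_simp
  linarith

theorem summable_pow_mul_div {r : ℝ} (h0 : 0 ≤ r) (h1 : r < 1) :
    Summable fun p : ℕ × ℕ ↦ r ^ ((p.1 + 1) * (p.2 + 1)) / (p.1 + 1) := by
  have hg := summable_geometric_of_lt_one h0 h1
  refine Summable.of_nonneg_of_le (fun p ↦ by positivity) (fun p ↦ ?_)
    (hg.mul_of_nonneg hg (fun _ ↦ by positivity) (fun _ ↦ by positivity))
  rw [← pow_add]
  refine (div_le_self (by positivity)
    (by linarith [(Nat.cast_nonneg p.1 : (0 : ℝ) ≤ p.1)])).trans ?_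
  exact pow_le_pow_of_le_one h0 h1.le (by nlinarith)

theorem tsum_tsum_pow_div {q : ℂ} (hq : ‖q‖ < 1) :
    ∑' m : ℕ, (∑' k : ℕ, (q ^ ((m + 1) * (k + 1))).re) / (m + 1) =
      -log ‖∏' k : ℕ, (1 - q ^ (k + 1))‖ := by
  have hS : Summable fun p : ℕ × ℕ ↦ (q ^ ((p.1 + 1) * (p.2 + 1))).re / (p.1 + 1) := by
    refine (summable_pow_mul_div (norm_nonneg q) hq).of_norm_bounded fun p ↦ ?_
    rw [norm_div, norm_of_nonneg (by positivity : (0 : ℝ) ≤ p.1 + 1), ← norm_pow]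
    gcongr
    exact Complex.abs_re_le_norm _
  have hqk : ∀ k : ℕ, ‖q ^ (k + 1)‖ < 1 := fun k ↦ by
    rw [norm_pow]; exact pow_lt_one₀ (norm_nonneg q) hq (by simp)
  have hlog : ∀ k : ℕ, ∑' m : ℕ, (q ^ ((m + 1) * (k + 1))).re / (m + 1) =
      -log ‖1 - q ^ (k + 1)‖ := fun k ↦ by
    have h := Complex.hasSum_re (Complex.hasSum_taylorSeries_neg_log (hqk k))
    rw [Complex.neg_re, Complex.log_re] at h
    rw [← h.tsum_eq, h.summable.tsum_eq_zero_add]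
    simp only [pow_zero, Nat.cast_zero, div_zero, Complex.zero_re, zero_add]
    refine tsum_congr fun m ↦ ?_
    rw [← pow_mul, mul_comm (k + 1), ← Complex.ofReal_natCast, Complex.div_ofReal_re]
    push_cast; rfl
  have hmul : Multipliable fun k : ℕ ↦ (1 - q ^ (k + 1)) :=
    ModularForm.multipliable_one_sub_pow hq
  have hpos : ∀ k : ℕ, 0 < ‖1 - q ^ (k + 1)‖ := fun k ↦ by
    rw [norm_pos_iff, sub_ne_zero]
    intro h
    have := hqk k
    rw [← h] at this
    simp at this
  have hls : Summable fun k : ℕ ↦ log ‖1 - q ^ (k + 1)‖ := by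
    have := hS.prod_symm.prod
    simp only [Prod.swap_prod_mk] at this
    simp_rw [hlog] at this
    exact summable_neg_iff.mp this
  rw [hmul.norm_tprod, ← rexp_tsum_eq_tprod hpos hls, log_exp, ← tsum_neg]
  simp_rw [← hlog, ← tsum_div_const]
  exact (Summable.tsum_comm (f := fun m k : ℕ ↦ (q ^ ((m + 1) * (k + 1))).re / (m + 1)) hS).symm

theorem norm_dedekindEta (z : ℍ) : ‖dedekindEta z‖ =
    exp (-π * z.im / 12) * ‖∏' k : ℕ, (1 - Complex.exp (2 * π * Complex.I * z) ^ (k + 1))‖ := by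
  rw [dedekindEta, norm_mul, Complex.norm_exp]
  have h : ∀ k : ℕ, 1 - Complex.exp (2 * π * Complex.I * ((k : ℂ) + 1) * z) =
      1 - Complex.exp (2 * π * Complex.I * z) ^ (k + 1) := fun k ↦ by
    rw [← Complex.exp_nat_mul]; push_cast; ring_nf
  rw [tprod_congr h]
  congr 2
  simp [Complex.div_ofNat_re]

theorem log_norm_dedekindEta (z : ℍ) : log ‖dedekindEta z‖ =
    -π * z.im / 12 + log ‖∏' k : ℕ, (1 - Complex.exp (2 * π * Complex.I * z) ^ (k + 1))‖ := by
  rw [norm_dedekindEta, log_mul (exp_pos _).ne', log_exp]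
  have := ModularForm.eta_tprod_ne_zero z.im_pos
  simp only [ModularForm.eta_q_eq_pow] at this
  simpa using this

theorem tsum_latticeDiff_one (z : ℍ) : ∑' p : ℕ × ℤ, latticeDiff z 1 (p.1 + 1) p.2 =
    -(2 * π / z.im) * (log ‖dedekindEta z‖ + π * z.im / 12) := by
  have hy := z.im_pos
  rw [(summable_latticeDiff z (s := 1) (by simp)).tsum_prod]
  have h : ∀ m : ℕ, ∑' n : ℤ, latticeDiff z 1 (m + 1) n = (2 * π / z.im) *
      ((∑' k : ℕ, (Complex.exp (2 * π * Complex.I * z) ^ ((m + 1) * (k + 1))).re) / (m + 1)) := by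
    intro m
    have hpi : ∫ t : ℝ, (1 + t ^ 2) ^ (-1 : ℝ) = π := by
      simp_rw [rpow_neg_one]; exact integral_univ_inv_one_add_sq
    rw [tsum_latticeDiff_int z (by simp), tsum_inv_latticeNormSq, hpi,
      show (1 : ℝ) - 2 * 1 = -1 by norm_num, rpow_neg_one]
    field_simp
    ring
  rw [tsum_congr h, tsum_mul_left, tsum_tsum_pow_div (UpperHalfPlane.norm_exp_two_pi_I_lt_one z),
    log_norm_dedekindEta]
  ring

theorem tsum_abs_int_rpow (s : ℝ) (hs : 1 / 2 < s) (z : ℍ) :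
    ∑' n : ℤ, latticeNormSq z 0 n ^ (-s) = 2 * ∑' n : ℕ, ((n : ℝ) + 1) ^ (-(2 * s)) := by
  have h : ∀ n : ℤ, latticeNormSq z 0 n ^ (-s) = |(n : ℝ)| ^ (-(2 * s)) := fun n ↦ by
    rw [latticeNormSq_rpow]; simp
  simp_rw [h]
  have hsum : Summable fun n : ℤ ↦ |(n : ℝ)| ^ (-(2 * s)) :=
    Real.summable_abs_int_rpow (by linarith)
  rw [tsum_int_eq_of_summable hsum, Int.cast_zero, abs_zero, zero_rpow (by linarith), zero_add,
    ← tsum_mul_left]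
  refine tsum_congr fun n ↦ ?_
  push_cast
  rw [abs_neg, abs_of_pos (by positivity)]
  ring

theorem tsum_latticeNormSq_rpow (z : ℍ) {s : ℝ} (hs : 1 < s) (hs2 : s ≤ 2) :
    ∑' p : ℤ × ℤ, latticeNormSq z p.1 p.2 ^ (-s) =
      2 * ∑' n : ℕ, ((n : ℝ) + 1) ^ (-(2 * s)) +
      2 * (∑' p : ℕ × ℤ, latticeDiff z s (p.1 + 1) p.2 +
        z.im ^ (1 - 2 * s) * (∑' n : ℕ, ((n : ℝ) + 1) ^ (-(2 * s - 1))) *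
          ∫ t : ℝ, (1 + t ^ 2) ^ (-s)) := by
  have hS := summable_latticeNormSq_rpow z hs
  have hsI : s ∈ Icc (1 : ℝ) 2 := ⟨hs.le, hs2⟩
  have hneg : ∀ m : ℤ, ∑' n : ℤ, latticeNormSq z ((-m : ℤ) : ℝ) n ^ (-s) =
      ∑' n : ℤ, latticeNormSq z m n ^ (-s) := fun m ↦ by
    rw [← (Equiv.neg ℤ).tsum_eq]
    refine tsum_congr fun n ↦ ?_
    rw [latticeNormSq, latticeNormSq, Equiv.neg_apply]
    push_cast
    ring_nf
  rw [hS.tsum_prod, tsum_int_eq_of_summable hS.prod]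
  simp_rw [hneg, ← two_mul]
  rw [Int.cast_zero, tsum_abs_int_rpow s (by linarith), tsum_mul_left]
  congr 2
  have hm : ∀ m : ℕ, ∑' n : ℤ, latticeNormSq z ((m + 1 : ℤ) : ℝ) n ^ (-s) =
      ∑' n : ℤ, latticeDiff z s (m + 1) n +
      z.im ^ (1 - 2 * s) * (((m : ℝ) + 1) ^ (-(2 * s - 1)) * ∫ t : ℝ, (1 + t ^ 2) ^ (-s)) := by
    intro m
    rw [tsum_latticeDiff_int z hsI, mul_rpow (by positivity) z.im_pos.le]
    push_cast
    ring_nf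
  have hz : Summable fun n : ℕ ↦ ((n : ℝ) + 1) ^ (-(2 * s - 1)) := by
    have := (summable_nat_add_iff 1).mpr
      (Real.summable_nat_rpow.mpr (by linarith : -(2 * s - 1) < -1))
    simpa using this
  rw [tsum_congr hm, (summable_latticeDiff z hsI).prod.tsum_add ((hz.mul_right _).mul_left _),
    (summable_latticeDiff z hsI).tsum_prod, tsum_mul_left, tsum_mul_right]
  ring

theorem tendsto_tsum_nat_rpow_two_mul :
    Tendsto (fun s : ℝ ↦ ∑' n : ℕ, ((n : ℝ) + 1) ^ (-(2 * s))) (𝓝[>] 1) (𝓝 (π ^ 2 / 6)) := by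
  have h2 : Summable fun n : ℕ ↦ ((n : ℝ) + 1) ^ (-2 : ℝ) := by
    have := (summable_nat_add_iff 1).mpr (Real.summable_nat_rpow.mpr (by norm_num : (-2 : ℝ) < -1))
    simpa using this
  have hv : ∑' n : ℕ, ((n : ℝ) + 1) ^ (-(2 * 1 : ℝ)) = π ^ 2 / 6 := by
    have h := hasSum_zeta_two
    rw [← h.tsum_eq, h.summable.tsum_eq_zero_add]
    simp
  rw [← hv]
  refine tendsto_tsum_of_dominated_convergence h2 (fun n ↦ ?_) ?_
  · refine Tendsto.mono_left (Continuous.tendsto ?_ 1) nhdsWithin_le_nhds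
    exact continuous_const.rpow (by fun_prop) fun _ ↦ Or.inl (by positivity)
  · filter_upwards [self_mem_nhdsWithin] with s hs n
    rw [norm_of_nonneg (by positivity)]
    exact rpow_le_rpow_of_exponent_le (by linarith [(Nat.cast_nonneg n : (0 : ℝ) ≤ n)])
      (by linarith [mem_Ioi.mp hs])

/-- The first limit formula of Kronecker. -/
theorem kronecker_limit (z : ℍ) :
    Tendsto (fun s : ℝ ↦ z.im ^ s * ∑' p : ℤ × ℤ, latticeNormSq z p.1 p.2 ^ (-s) - π / (s - 1))
      (𝓝[>] 1) (𝓝 (2 * π * (eulerMascheroniConstant - log 2) - π * log z.im -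
        4 * π * log ‖dedekindEta z‖)) := by
  have hy := z.im_pos
  set h : ℝ → ℝ := fun s ↦ z.im ^ (1 - s) * (√π * Gamma (s - 1 / 2) / Gamma s) with hh
  have hd : HasDerivAt h (-π * log z.im - 2 * π * log 2) 1 := by
    have h1 : HasDerivAt (fun s : ℝ ↦ z.im ^ (1 - s)) (-log z.im) 1 := by
      have := ((hasDerivAt_id (1 : ℝ)).const_sub 1).const_rpow hy
      simpa using this
    have h2 := h1.mul hasDerivAt_Gamma_quotient
    refine h2.congr_deriv ?_
    rw [show (1 : ℝ) - 1 / 2 = 1 / 2 by norm_num, Gamma_one_half_eq, Gamma_one, div_one,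
      Real.mul_self_sqrt pi_pos.le]
    simp
    ring
  have h1 : h 1 = π := by
    simp only [hh]
    rw [show (1 : ℝ) - 1 / 2 = 1 / 2 by norm_num, Gamma_one_half_eq, Gamma_one, div_one,
      Real.mul_self_sqrt pi_pos.le]
    simp
  have hslope : Tendsto (fun s ↦ (h s - π) / (s - 1)) (𝓝[>] 1)
      (𝓝 (-π * log z.im - 2 * π * log 2)) := by
    have := (hasDerivAt_iff_tendsto_slope.mp hd).mono_left
      (nhdsWithin_mono 1 fun x (hx : 1 < x) ↦ (ne_of_gt hx : x ≠ 1))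
    refine this.congr fun s ↦ ?_
    rw [slope_def_field, h1]
  have hcont : Tendsto h (𝓝[>] 1) (𝓝 π) := by
    rw [← h1]; exact hd.continuousAt.tendsto.mono_left nhdsWithin_le_nhds
  have hζ : Tendsto (fun s : ℝ ↦ (∑' n : ℕ, ((n : ℝ) + 1) ^ (-(2 * s - 1))) - 1 / (2 * s - 1 - 1))
      (𝓝[>] 1) (𝓝 eulerMascheroniConstant) := by
    refine tendsto_tsum_rpow_sub_one_div.comp (f := fun s : ℝ ↦ 2 * s - 1) ?_
    refine tendsto_nhdsWithin_iff.mpr ⟨?_, ?_⟩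
    · refine Tendsto.mono_left (Continuous.tendsto' (by fun_prop) _ _ (by norm_num))
        nhdsWithin_le_nhds
    · filter_upwards [self_mem_nhdsWithin] with s hs
      simp only [mem_Ioi] at *
      linarith
  have hys : Tendsto (fun s : ℝ ↦ z.im ^ s) (𝓝[>] 1) (𝓝 z.im) := by
    refine Tendsto.mono_left (Continuous.tendsto' ?_ _ _ (rpow_one _)) nhdsWithin_le_nhds
    exact continuous_const.rpow continuous_id fun _ ↦ Or.inl hy.ne'
  have hlim := ((((hys.mul tendsto_tsum_nat_rpow_two_mul).const_mul 2).add
    ((hys.mul (tendsto_tsum_latticeDiff z)).const_mul 2)).add ((hcont.mul hζ).const_mul 2)).add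
    hslope
  refine (hlim.congr' ?_).trans_eq ?_
  · filter_upwards [Ioo_mem_nhdsGT (show (1 : ℝ) < 2 by norm_num)] with s hs
    have hs1 : s - 1 ≠ 0 := by linarith [hs.1]
    rw [tsum_latticeNormSq_rpow z hs.1 hs.2.le, integral_one_add_sq_rpow_neg (by linarith [hs.1])]
    have he : z.im ^ (1 - s) = z.im ^ s * z.im ^ (1 - 2 * s) := by
      rw [← rpow_add hy]; ring_nf
    simp only [hh]
    rw [he, show 2 * s - 1 - 1 = 2 * (s - 1) by ring]
    field_simp
    ring
  · rw [tsum_latticeDiff_one]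
    congr 1
    field_simp
    ring

/-- The value `a x² + b x y + c y²` of an integral binary quadratic form. -/
def qf (a b c : ℤ) (p : ℤ × ℤ) : ℤ := a * p.1 ^ 2 + b * p.1 * p.2 + c * p.2 ^ 2

/-- The Epstein zeta function of an integral binary quadratic form. -/
noncomputable def epsteinZeta (a b c : ℤ) (s : ℝ) : ℝ := ∑' p : ℤ × ℤ, (qf a b c p : ℝ) ^ (-s)

/-- The point `(3 + √-15) / 6` of the upper half-plane. -/
noncomputable def cmPoint : ℍ := ⟨(3 + √15 * Complex.I) / 6, by simp⟩

/-- Multiplication of a point of the upper half-plane by a positive natural number. -/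
noncomputable def nsmulPoint (k : ℕ) (hk : 0 < k) (z : ℍ) : ℍ :=
  ⟨k * z, by simpa using mul_pos (Nat.cast_pos.mpr hk) z.im_pos⟩

theorem hasSum_int_even_add_odd {f : ℤ → ℝ} {a b : ℝ} (he : HasSum (fun k ↦ f (2 * k)) a)
    (ho : HasSum (fun k ↦ f (2 * k + 1)) b) : HasSum f (a + b) := by
  have := mul_right_injective₀ (two_ne_zero' ℤ)
  replace ho := ((add_left_injective 1).comp this).hasSum_range_iff.2 ho
  refine (this.hasSum_range_iff.2 he).add_isCompl ?_ ho
  simpa [Function.comp_def] using Int.isCompl_even_odd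

theorem tsum_prod_swap (f : ℤ × ℤ → ℝ) : ∑' p, f p = ∑' p : ℤ × ℤ, f (p.2, p.1) :=
  ((Equiv.prodComm ℤ ℤ).tsum_eq f).symm

theorem tsum_snd_even_add_odd {f : ℤ × ℤ → ℝ} (hf : Summable f) :
    ∑' p, f p = ∑' p : ℤ × ℤ, f (p.1, 2 * p.2) + ∑' p : ℤ × ℤ, f (p.1, 2 * p.2 + 1) := by
  have he : Summable fun p : ℤ × ℤ ↦ f (p.2, 2 * p.1) :=
    hf.comp_injective (i := fun p : ℤ × ℤ ↦ (p.2, 2 * p.1)) fun p q h ↦ by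
      simp only [Prod.mk.injEq] at h; ext <;> omega
  have ho : Summable fun p : ℤ × ℤ ↦ f (p.2, 2 * p.1 + 1) :=
    hf.comp_injective (i := fun p : ℤ × ℤ ↦ (p.2, 2 * p.1 + 1)) fun p q h ↦ by
      simp only [Prod.mk.injEq] at h; ext <;> omega
  have hs : Summable fun p : ℤ × ℤ ↦ f (p.2, p.1) := hf.prod_symm
  rw [tsum_prod_swap f, tsum_prod_swap fun p ↦ f (p.1, 2 * p.2),
    tsum_prod_swap fun p ↦ f (p.1, 2 * p.2 + 1), hs.tsum_prod, he.tsum_prod, ho.tsum_prod]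
  exact (hasSum_int_even_add_odd (f := fun y ↦ ∑' x : ℤ, f (x, y))
    he.prod.hasSum ho.prod.hasSum).tsum_eq

theorem tsum_fst_even_add_odd {f : ℤ × ℤ → ℝ} (hf : Summable f) :
    ∑' p, f p = ∑' p : ℤ × ℤ, f (2 * p.1, p.2) + ∑' p : ℤ × ℤ, f (2 * p.1 + 1, p.2) := by
  rw [tsum_prod_swap f, tsum_prod_swap fun p ↦ f (2 * p.1, p.2),
    tsum_prod_swap fun p ↦ f (2 * p.1 + 1, p.2)]
  exact tsum_snd_even_add_odd (f := fun p ↦ f (p.2, p.1)) hf.prod_symm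

/-- The unipotent substitution `(x, y) ↦ (x + k y, y)`. -/
def shearFst (k : ℤ) : ℤ × ℤ ≃ ℤ × ℤ where
  toFun p := (p.1 + k * p.2, p.2)
  invFun p := (p.1 - k * p.2, p.2)
  left_inv p := by simp
  right_inv p := by simp

theorem epsteinZeta_shear (a b c k : ℤ) (s : ℝ) :
    epsteinZeta a (2 * a * k + b) (a * k ^ 2 + b * k + c) s = epsteinZeta a b c s := by
  unfold epsteinZeta
  rw [← (shearFst k).tsum_eq fun p ↦ (qf a b c p : ℝ) ^ (-s)]
  refine tsum_congr fun p ↦ ?_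
  congr 2
  simp only [qf, shearFst, Equiv.coe_fn_mk]
  ring

theorem epsteinZeta_swap (a b c : ℤ) (s : ℝ) : epsteinZeta a b c s = epsteinZeta c b a s := by
  unfold epsteinZeta
  rw [← (Equiv.prodComm ℤ ℤ).tsum_eq]
  refine tsum_congr fun p ↦ ?_
  congr 2
  simp only [qf, Equiv.prodComm_apply, Prod.fst_swap, Prod.snd_swap]
  ring

theorem epsteinZeta_smul {a b c k : ℤ} (hk : 0 ≤ k) (h : ∀ p, 0 ≤ qf a b c p) (s : ℝ) :
    epsteinZeta (k * a) (k * b) (k * c) s = (k : ℝ) ^ (-s) * epsteinZeta a b c s := by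
  unfold epsteinZeta
  rw [← tsum_mul_left]
  refine tsum_congr fun p ↦ ?_
  rw [← mul_rpow (by exact_mod_cast hk) (by exact_mod_cast h p)]
  congr 1
  simp only [qf]
  push_cast
  ring

theorem qf_one_one_four_nonneg (p : ℤ × ℤ) : 0 ≤ qf 1 1 4 p := by
  unfold qf; nlinarith [sq_nonneg (2 * p.1 + p.2), sq_nonneg p.2]

theorem qf_two_one_two_nonneg (p : ℤ × ℤ) : 0 ≤ qf 2 1 2 p := by
  unfold qf; nlinarith [sq_nonneg (4 * p.1 + p.2), sq_nonneg p.2]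

theorem cmPoint_re : cmPoint.re = 1 / 2 := by
  change ((3 + √15 * Complex.I) / 6 : ℂ).re = _
  simp [Complex.div_ofNat_re]; norm_num

theorem cmPoint_im : cmPoint.im = √15 / 6 := by
  change ((3 + √15 * Complex.I) / 6 : ℂ).im = _
  simp [Complex.div_ofNat_im]

theorem nsmulPoint_re (k : ℕ) (hk : 0 < k) (z : ℍ) : (nsmulPoint k hk z).re = k * z.re := by
  change ((k : ℂ) * z).re = _
  simp

theorem nsmulPoint_im (k : ℕ) (hk : 0 < k) (z : ℍ) : (nsmulPoint k hk z).im = k * z.im := by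
  change ((k : ℂ) * z).im = _
  simp

theorem latticeNormSq_nsmulPoint_cmPoint (k : ℕ) (hk : 0 < k) (m n : ℝ) :
    latticeNormSq (nsmulPoint k hk cmPoint) m n = n ^ 2 + k * n * m + 2 / 3 * k ^ 2 * m ^ 2 := by
  rw [latticeNormSq, nsmulPoint_re, nsmulPoint_im, cmPoint_re, cmPoint_im]
  ring_nf
  rw [Real.sq_sqrt (by norm_num)]
  ring

theorem im_rpow_mul_tsum_nsmulPoint (k : ℕ) (hk : 0 < k) {d a b c : ℤ} (hd : 0 < d)
    (h1 : a = d) (h2 : b = d * k) (h3 : 3 * c = 2 * d * k ^ 2) (s : ℝ) :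
    (nsmulPoint k hk cmPoint).im ^ s *
      ∑' p : ℤ × ℤ, latticeNormSq (nsmulPoint k hk cmPoint) p.1 p.2 ^ (-s) =
      (d * k * √15 / 6) ^ s * epsteinZeta a b c s := by
  have hd' : (0 : ℝ) < d := by exact_mod_cast hd
  have hk' : (0 : ℝ) < k := by exact_mod_cast hk
  have h3' : (3 : ℝ) * c = 2 * d * k ^ 2 := by exact_mod_cast h3
  have : epsteinZeta a b c s =
      (d : ℝ) ^ (-s) * ∑' p : ℤ × ℤ, latticeNormSq (nsmulPoint k hk cmPoint) p.1 p.2 ^ (-s) := by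
    unfold epsteinZeta
    rw [← (Equiv.prodComm ℤ ℤ).tsum_eq, ← tsum_mul_left]
    refine tsum_congr fun p ↦ ?_
    rw [← mul_rpow hd'.le (latticeNormSq_nonneg ..), latticeNormSq_nsmulPoint_cmPoint]
    congr 1
    simp only [qf, Equiv.prodComm_apply, Prod.fst_swap, Prod.snd_swap]
    rw [h1, h2]
    push_cast
    linear_combination (1 / 3) * (p.1 : ℝ) ^ 2 * h3'
  rw [this, nsmulPoint_im, cmPoint_im, ← mul_assoc,
    show d * k * √15 / 6 = d * (k * (√15 / 6)) by ring,
    mul_rpow hd'.le (by positivity), mul_right_comm _ _ ((d : ℝ) ^ (-s)), ← rpow_add hd']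
  simp

theorem im_rpow_mul_tsum_one (s : ℝ) : (nsmulPoint 1 one_pos cmPoint).im ^ s *
    ∑' p : ℤ × ℤ, latticeNormSq (nsmulPoint 1 one_pos cmPoint) p.1 p.2 ^ (-s) =
      (√15 / 2) ^ s * epsteinZeta 2 1 2 s := by
  rw [im_rpow_mul_tsum_nsmulPoint 1 one_pos (d := 3) (a := 3) (b := 3) (c := 2) (by norm_num) rfl
    (by norm_num) (by norm_num), ← epsteinZeta_shear 2 1 2 (-1) s, epsteinZeta_swap 3 3 2]
  have := epsteinZeta_shear 2 (-3) 3 0 s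
  have h2 : epsteinZeta 2 (-3) 3 s = epsteinZeta 2 3 3 s := by
    unfold epsteinZeta
    rw [← ((Equiv.neg ℤ).prodCongr (Equiv.refl ℤ)).tsum_eq]
    refine tsum_congr fun p ↦ ?_
    congr 2
    simp [qf]
  rw [← h2]
  norm_num
  left
  congr 1
  ring

theorem im_rpow_mul_tsum_three (s : ℝ) : (nsmulPoint 3 three_pos cmPoint).im ^ s *
    ∑' p : ℤ × ℤ, latticeNormSq (nsmulPoint 3 three_pos cmPoint) p.1 p.2 ^ (-s) =
      (√15 / 2) ^ s * epsteinZeta 1 1 4 s := by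
  rw [im_rpow_mul_tsum_nsmulPoint 3 three_pos (d := 1) (a := 1) (b := 3) (c := 6) (by norm_num) rfl
    (by norm_num) (by norm_num), ← epsteinZeta_shear 1 1 4 1 s]
  norm_num
  left
  congr 1
  ring

theorem im_rpow_mul_tsum_two (s : ℝ) : (nsmulPoint 2 two_pos cmPoint).im ^ s *
    ∑' p : ℤ × ℤ, latticeNormSq (nsmulPoint 2 two_pos cmPoint) p.1 p.2 ^ (-s) =
      √15 ^ s * epsteinZeta 3 0 5 s := by
  rw [im_rpow_mul_tsum_nsmulPoint 2 two_pos (d := 3) (a := 3) (b := 6) (c := 8) (by norm_num) rfl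
    (by norm_num) (by norm_num), ← epsteinZeta_shear 3 0 5 1 s]
  norm_num

theorem im_rpow_mul_tsum_six (s : ℝ) : (nsmulPoint 6 (by norm_num) cmPoint).im ^ s *
    ∑' p : ℤ × ℤ, latticeNormSq (nsmulPoint 6 (by norm_num) cmPoint) p.1 p.2 ^ (-s) =
      √15 ^ s * epsteinZeta 1 0 15 s := by
  rw [im_rpow_mul_tsum_nsmulPoint 6 (by norm_num) (d := 1) (a := 1) (b := 6) (c := 24) (by norm_num)
    rfl (by norm_num) (by norm_num), ← epsteinZeta_shear 1 0 15 3 s]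
  norm_num

theorem summable_of_linear_qf (z : ℍ) (s : ℝ) (hs : 1 < s) {f : ℤ × ℤ → ℤ} (e : ℤ × ℤ ≃ ℤ × ℤ)
    (d : ℝ) (h : ∀ p, (f (e p) : ℝ) = d * latticeNormSq z p.1 p.2) (hd : 0 ≤ d) :
    Summable fun p ↦ (f p : ℝ) ^ (-s) := by
  rw [← e.summable_iff]
  refine ((summable_latticeNormSq_rpow z hs).mul_left (d ^ (-s))).congr fun p ↦ ?_
  rw [Function.comp_apply, h, mul_rpow hd (latticeNormSq_nonneg ..)]

theorem summable_qf_one_one_four {s : ℝ} (hs : 1 < s) :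
    Summable fun p ↦ (qf 1 1 4 p : ℝ) ^ (-s) := by
  refine summable_of_linear_qf (nsmulPoint 3 three_pos cmPoint) s hs
    ((Equiv.prodComm ℤ ℤ).trans (shearFst 1)) 1 (fun p ↦ ?_) one_pos.le
  rw [latticeNormSq_nsmulPoint_cmPoint]
  simp only [qf, shearFst, Equiv.trans_apply, Equiv.prodComm_apply, Prod.fst_swap, Prod.snd_swap,
    Equiv.coe_fn_mk]
  push_cast
  ring

theorem summable_qf_two_one_two {s : ℝ} (hs : 1 < s) :
    Summable fun p ↦ (qf 2 1 2 p : ℝ) ^ (-s) := by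
  refine summable_of_linear_qf (nsmulPoint 1 one_pos cmPoint) s hs
    ((shearFst 1).trans ((Equiv.refl ℤ).prodCongr (Equiv.neg ℤ))) 3 (fun p ↦ ?_) (by norm_num)
  rw [latticeNormSq_nsmulPoint_cmPoint]
  simp only [qf, shearFst, Equiv.trans_apply, Equiv.prodCongr_apply, Prod.map, Equiv.refl_apply,
    Equiv.neg_apply, Equiv.coe_fn_mk]
  push_cast
  ring

theorem epsteinZeta_one_zero_fifteen {s : ℝ} (hs : 1 < s) : epsteinZeta 1 0 15 s =
    epsteinZeta 1 1 4 s -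
      2 * (2 ^ (-s) * epsteinZeta 2 1 2 s - 4 ^ (-s) * epsteinZeta 1 1 4 s) := by
  have hS := summable_qf_one_one_four hs
  have h0 : epsteinZeta 1 0 15 s = ∑' p : ℤ × ℤ, (qf 1 1 4 (p.1, 2 * p.2) : ℝ) ^ (-s) := by
    rw [← epsteinZeta_shear 1 0 15 1]
    unfold epsteinZeta
    refine tsum_congr fun p ↦ ?_
    congr 2
    simp only [qf]
    ring
  have h1 : epsteinZeta 1 1 4 s = ∑' p : ℤ × ℤ, (qf 1 1 4 (p.1, 2 * p.2) : ℝ) ^ (-s) +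
      ∑' p : ℤ × ℤ, (qf 1 1 4 (p.1, 2 * p.2 + 1) : ℝ) ^ (-s) := tsum_snd_even_add_odd hS
  have hS2 : Summable fun p : ℤ × ℤ ↦ (qf 1 1 4 (p.1, 2 * p.2 + 1) : ℝ) ^ (-s) :=
    hS.comp_injective (i := fun p : ℤ × ℤ ↦ (p.1, 2 * p.2 + 1)) fun p q h ↦ by
      simp only [Prod.mk.injEq] at h; ext <;> omega
  have hS3 : Summable fun p : ℤ × ℤ ↦ (qf 1 1 4 (2 * p.1, p.2) : ℝ) ^ (-s) :=
    hS.comp_injective (i := fun p : ℤ × ℤ ↦ (2 * p.1, p.2)) fun p q h ↦ by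
      simp only [Prod.mk.injEq] at h; ext <;> omega
  have h2 := tsum_fst_even_add_odd hS2
  have h3 := tsum_snd_even_add_odd hS3
  have h4 : ∑' p : ℤ × ℤ, (qf 1 1 4 (2 * p.1 + 1, 2 * p.2 + 1) : ℝ) ^ (-s) =
      ∑' p : ℤ × ℤ, (qf 1 1 4 (2 * p.1, 2 * p.2 + 1) : ℝ) ^ (-s) := by
    let e : ℤ × ℤ ≃ ℤ × ℤ :=
      { toFun p := (-p.1 - p.2 - 1, p.2)
        invFun p := (-p.1 - p.2 - 1, p.2)
        left_inv p := by ext <;> grind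
        right_inv p := by ext <;> grind }
    rw [← e.tsum_eq]
    refine tsum_congr fun p ↦ ?_
    congr 2
    simp only [qf, e, Equiv.coe_fn_mk]
    ring
  have h5 : ∑' p : ℤ × ℤ, (qf 1 1 4 (2 * p.1, p.2) : ℝ) ^ (-s) =
      2 ^ (-s) * epsteinZeta 2 1 2 s := by
    have := epsteinZeta_smul (k := 2) (by norm_num) qf_two_one_two_nonneg s
    norm_cast at this ⊢
    rw [← this]
    refine tsum_congr fun p ↦ ?_
    congr 2
    simp only [qf]
    ring
  have h6 : ∑' p : ℤ × ℤ, (qf 1 1 4 (2 * p.1, 2 * p.2) : ℝ) ^ (-s) =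
      4 ^ (-s) * epsteinZeta 1 1 4 s := by
    have := epsteinZeta_smul (k := 4) (by norm_num) qf_one_one_four_nonneg s
    norm_cast at this ⊢
    rw [← this]
    refine tsum_congr fun p ↦ ?_
    congr 2
    simp only [qf]
    ring
  linarith

theorem epsteinZeta_three_zero_five {s : ℝ} (hs : 1 < s) : epsteinZeta 3 0 5 s =
    epsteinZeta 2 1 2 s -
      2 * (2 ^ (-s) * epsteinZeta 1 1 4 s - 4 ^ (-s) * epsteinZeta 2 1 2 s) := by
  have hS := summable_qf_two_one_two hs
  have hT : Summable fun p : ℤ × ℤ ↦ (qf 2 1 2 (p.1, p.1 + p.2) : ℝ) ^ (-s) :=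
    hS.comp_injective (i := fun p : ℤ × ℤ ↦ (p.1, p.1 + p.2)) fun p q h ↦ by
      simp only [Prod.mk.injEq] at h; ext <;> omega
  have h0 : epsteinZeta 3 0 5 s =
      ∑' p : ℤ × ℤ, (qf 2 1 2 (p.1, p.1 + 2 * p.2) : ℝ) ^ (-s) := by
    rw [epsteinZeta_swap, ← epsteinZeta_shear 5 0 3 1]
    unfold epsteinZeta
    refine tsum_congr fun p ↦ ?_
    congr 2
    simp only [qf]
    ring
  have hsh : epsteinZeta 2 1 2 s = ∑' p : ℤ × ℤ, (qf 2 1 2 (p.1, p.1 + p.2) : ℝ) ^ (-s) := by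
    rw [epsteinZeta_swap, ← epsteinZeta_shear 2 1 2 1, epsteinZeta_swap]
    unfold epsteinZeta
    refine tsum_congr fun p ↦ ?_
    congr 2
    simp only [qf]
    ring
  have h1 := hsh.trans (tsum_snd_even_add_odd hT)
  have hS2 : Summable fun p : ℤ × ℤ ↦ (qf 2 1 2 (p.1, p.1 + (2 * p.2 + 1)) : ℝ) ^ (-s) :=
    hS.comp_injective (i := fun p : ℤ × ℤ ↦ (p.1, p.1 + (2 * p.2 + 1))) fun p q h ↦ by
      simp only [Prod.mk.injEq] at h; ext <;> omega
  have hS3 : Summable fun p : ℤ × ℤ ↦ (qf 2 1 2 (2 * p.1, p.2) : ℝ) ^ (-s) :=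
    hS.comp_injective (i := fun p : ℤ × ℤ ↦ (2 * p.1, p.2)) fun p q h ↦ by
      simp only [Prod.mk.injEq] at h; ext <;> omega
  have h2 := tsum_fst_even_add_odd hS2
  have h3 := tsum_snd_even_add_odd hS3
  have h4 : ∑' p : ℤ × ℤ, (qf 2 1 2 (2 * p.1 + 1, 2 * p.1 + 1 + (2 * p.2 + 1)) : ℝ) ^ (-s) =
      ∑' p : ℤ × ℤ, (qf 2 1 2 (2 * p.1, 2 * p.2 + 1) : ℝ) ^ (-s) := by
    let e : ℤ × ℤ ≃ ℤ × ℤ :=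
      { toFun p := (p.1 + p.2 + 1, p.1)
        invFun p := (p.2, p.1 - p.2 - 1)
        left_inv p := by ext <;> grind
        right_inv p := by ext <;> grind }
    rw [← e.tsum_eq fun p : ℤ × ℤ ↦ (qf 2 1 2 (2 * p.1, 2 * p.2 + 1) : ℝ) ^ (-s)]
    refine tsum_congr fun p ↦ ?_
    congr 2
    simp only [qf, e, Equiv.coe_fn_mk]
    ring
  have h4' : ∑' p : ℤ × ℤ, (qf 2 1 2 (2 * p.1, 2 * p.1 + (2 * p.2 + 1)) : ℝ) ^ (-s) =
      ∑' p : ℤ × ℤ, (qf 2 1 2 (2 * p.1, 2 * p.2 + 1) : ℝ) ^ (-s) := by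
    let e : ℤ × ℤ ≃ ℤ × ℤ :=
      { toFun p := (p.1, p.1 + p.2)
        invFun p := (p.1, p.2 - p.1)
        left_inv p := by ext <;> grind
        right_inv p := by ext <;> grind }
    rw [← e.tsum_eq fun p : ℤ × ℤ ↦ (qf 2 1 2 (2 * p.1, 2 * p.2 + 1) : ℝ) ^ (-s)]
    refine tsum_congr fun p ↦ ?_
    congr 2
    simp only [qf, e, Equiv.coe_fn_mk]
    ring
  have h5 : ∑' p : ℤ × ℤ, (qf 2 1 2 (2 * p.1, p.2) : ℝ) ^ (-s) =
      2 ^ (-s) * epsteinZeta 1 1 4 s := by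
    have := epsteinZeta_smul (k := 2) (by norm_num) qf_one_one_four_nonneg s
    rw [epsteinZeta_swap] at this
    norm_cast at this ⊢
    rw [← this]
    unfold epsteinZeta
    rw [tsum_prod_swap]
    rw [tsum_prod_swap]
    refine tsum_congr fun p ↦ ?_
    congr 2
    simp only [qf]
    ring
  have h6 : ∑' p : ℤ × ℤ, (qf 2 1 2 (2 * p.1, 2 * p.2) : ℝ) ^ (-s) =
      4 ^ (-s) * epsteinZeta 2 1 2 s := by
    have := epsteinZeta_smul (k := 4) (by norm_num) qf_two_one_two_nonneg s
    norm_cast at this ⊢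
    rw [← this]
    refine tsum_congr fun p ↦ ?_
    congr 2
    simp only [qf]
    ring
  linarith

theorem dedekindEta_ne_zero (z : ℍ) : dedekindEta z ≠ 0 := by
  rw [← norm_ne_zero_iff, norm_dedekindEta]
  have := ModularForm.eta_tprod_ne_zero z.im_pos
  simp only [ModularForm.eta_q_eq_pow] at this
  simpa using this

theorem norm_dedekindEta_pos (z : ℍ) : 0 < ‖dedekindEta z‖ :=
  norm_pos_iff.mpr (dedekindEta_ne_zero z)

theorem tendsto_epsteinZeta_one_three :
    Tendsto (fun s : ℝ ↦ (√15 / 2) ^ s * (epsteinZeta 2 1 2 s + epsteinZeta 1 1 4 s) -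
      2 * π / (s - 1)) (𝓝[>] 1) (𝓝 (4 * π * (eulerMascheroniConstant - log 2) - π * log (5 / 4) -
        4 * π * log (‖dedekindEta cmPoint‖ * ‖dedekindEta (3 * cmPoint)‖))) := by
  have h1 := kronecker_limit (nsmulPoint 1 one_pos cmPoint)
  have h3 := kronecker_limit (nsmulPoint 3 three_pos cmPoint)
  have e1 : ((nsmulPoint 1 one_pos cmPoint : ℍ) : ℂ) = cmPoint := by
    change ((1 : ℕ) : ℂ) * (cmPoint : ℂ) = _; simp
  have e3 : ((nsmulPoint 3 three_pos cmPoint : ℍ) : ℂ) = 3 * cmPoint := rfl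
  have p1 := norm_dedekindEta_pos (nsmulPoint 1 one_pos cmPoint)
  have p3 := norm_dedekindEta_pos (nsmulPoint 3 three_pos cmPoint)
  simp_rw [im_rpow_mul_tsum_one, e1] at h1
  simp_rw [im_rpow_mul_tsum_three, e3] at h3
  rw [e1] at p1
  rw [e3] at p3
  refine ((h1.add h3).congr fun s ↦ by ring).trans_eq ?_
  have : log (5 / 4) = log (nsmulPoint 1 one_pos cmPoint).im +
      log (nsmulPoint 3 three_pos cmPoint).im := by
    rw [← log_mul (nsmulPoint 1 one_pos cmPoint).im_pos.ne'
      (nsmulPoint 3 three_pos cmPoint).im_pos.ne',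
      nsmulPoint_im, nsmulPoint_im, cmPoint_im]
    congr 1
    push_cast
    ring_nf
    rw [Real.sq_sqrt (by norm_num)]
    norm_num
  rw [log_mul p1.ne' p3.ne', this]
  congr 1
  ring

theorem tendsto_epsteinZeta_two_six :
    Tendsto (fun s : ℝ ↦ √15 ^ s * (epsteinZeta 3 0 5 s + epsteinZeta 1 0 15 s) -
      2 * π / (s - 1)) (𝓝[>] 1) (𝓝 (4 * π * (eulerMascheroniConstant - log 2) - π * log 5 -
        4 * π * log (‖dedekindEta (2 * cmPoint)‖ * ‖dedekindEta (6 * cmPoint)‖))) := by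
  have h1 := kronecker_limit (nsmulPoint 2 two_pos cmPoint)
  have h3 := kronecker_limit (nsmulPoint 6 (by norm_num) cmPoint)
  have e1 : ((nsmulPoint 2 two_pos cmPoint : ℍ) : ℂ) = 2 * cmPoint := rfl
  have e3 : ((nsmulPoint 6 (by norm_num) cmPoint : ℍ) : ℂ) = 6 * cmPoint := rfl
  have p1 := norm_dedekindEta_pos (nsmulPoint 2 two_pos cmPoint)
  have p3 := norm_dedekindEta_pos (nsmulPoint 6 (by norm_num) cmPoint)
  simp_rw [im_rpow_mul_tsum_two, e1] at h1
  simp_rw [im_rpow_mul_tsum_six, e3] at h3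
  rw [e1] at p1
  rw [e3] at p3
  refine ((h1.add h3).congr fun s ↦ by ring).trans_eq ?_
  have : log 5 = log (nsmulPoint 2 two_pos cmPoint).im +
      log (nsmulPoint 6 (by norm_num) cmPoint).im := by
    rw [← log_mul (nsmulPoint 2 two_pos cmPoint).im_pos.ne'
      (nsmulPoint 6 (by norm_num) cmPoint).im_pos.ne', nsmulPoint_im, nsmulPoint_im, cmPoint_im]
    congr 1
    push_cast
    ring_nf
    rw [Real.sq_sqrt (by norm_num)]
    norm_num
  rw [log_mul p1.ne' p3.ne', this]
  congr 1
  ring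

theorem norm_dedekindEta_two_mul_six :
    ‖dedekindEta (2 * cmPoint)‖ * ‖dedekindEta (6 * cmPoint)‖ =
      ‖dedekindEta cmPoint‖ * ‖dedekindEta (3 * cmPoint)‖ / 2 := by
  have hF := tendsto_epsteinZeta_one_three
  have hG := tendsto_epsteinZeta_two_six
  set F : ℝ → ℝ := fun s ↦ (√15 / 2) ^ s * (epsteinZeta 2 1 2 s + epsteinZeta 1 1 4 s) with hFd
  set g : ℝ → ℝ := fun s ↦ 2 ^ s + 2 * 2 ^ (-s) with hg
  have hgd : HasDerivAt g (log 2) 1 := by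
    have h1 := (hasDerivAt_id (1 : ℝ)).const_rpow (show (0 : ℝ) < 2 by norm_num)
    have h2 := ((hasDerivAt_id (1 : ℝ)).neg.const_rpow (show (0 : ℝ) < 2 by norm_num)).const_mul 2
    refine (h1.add h2).congr_deriv ?_
    simp [rpow_neg_one]
    ring
  have hslope : Tendsto (fun s ↦ (g s - 3) / (s - 1)) (𝓝[>] 1) (𝓝 (log 2)) := by
    have := (hasDerivAt_iff_tendsto_slope.mp hgd).mono_left
      (nhdsWithin_mono 1 fun x (hx : 1 < x) ↦ (ne_of_gt hx : x ≠ 1))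
    refine this.congr fun s ↦ ?_
    rw [slope_def_field]
    simp only [hg]
    norm_num
  have hs1 : Tendsto (fun s : ℝ ↦ s - 1) (𝓝[>] 1) (𝓝 0) :=
    Tendsto.mono_left (Continuous.tendsto' (by fun_prop) _ _ (by norm_num))
        nhdsWithin_le_nhds
  have hFs : Tendsto (fun s ↦ (s - 1) * F s) (𝓝[>] 1) (𝓝 (2 * π)) := by
    have := (hs1.mul hF).add_const (2 * π)
    rw [zero_mul, zero_add] at this
    refine this.congr' ?_
    filter_upwards [self_mem_nhdsWithin] with s hs
    have : s - 1 ≠ 0 := by linarith [mem_Ioi.mp hs]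
    field_simp
    ring
  have hdiff := hG.sub hF
  have hdiff' := (hslope.mul hFs).congr' (f₂ := fun s ↦ (√15 ^ s * (epsteinZeta 3 0 5 s +
      epsteinZeta 1 0 15 s) - 2 * π / (s - 1)) - (F s - 2 * π / (s - 1))) (by
    filter_upwards [self_mem_nhdsWithin] with s hs
    have h0 : s - 1 ≠ 0 := by linarith [mem_Ioi.mp hs]
    rw [epsteinZeta_three_zero_five hs, epsteinZeta_one_zero_fifteen hs]
    have h4 : (4 : ℝ) ^ (-s) = 2 ^ (-s) * 2 ^ (-s) := by
      rw [← mul_rpow (by norm_num) (by norm_num)]; norm_num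
    have h2 : (2 : ℝ) ^ s * 2 ^ (-s) = 1 := by rw [← rpow_add (by norm_num)]; simp
    have h15 : √15 ^ s = 2 ^ s * (√15 / 2) ^ s := by
      rw [← mul_rpow (by norm_num) (by positivity)]; congr 1; ring
    rw [h4, h15, div_mul_eq_mul_div, mul_comm (s - 1), ← mul_assoc, mul_div_assoc, div_self h0]
    simp only [hg, hFd]
    linear_combination (-(√15 / 2) ^ s * (epsteinZeta 2 1 2 s + epsteinZeta 1 1 4 s) *
      (2 * 2 ^ (-s) - 2)) * h2)
  have hkey := tendsto_nhds_unique hdiff hdiff'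
  have p1 : 0 < ‖dedekindEta cmPoint‖ * ‖dedekindEta (3 * cmPoint)‖ :=
    mul_pos (norm_dedekindEta_pos cmPoint) (norm_dedekindEta_pos (nsmulPoint 3 three_pos cmPoint))
  have p2 : 0 < ‖dedekindEta (2 * cmPoint)‖ * ‖dedekindEta (6 * cmPoint)‖ :=
    mul_pos (norm_dedekindEta_pos (nsmulPoint 2 two_pos cmPoint))
      (norm_dedekindEta_pos (nsmulPoint 6 (by norm_num) cmPoint))
  have h54 : log (5 / 4) = log 5 - 2 * log 2 := by
    rw [log_div (by norm_num) (by norm_num), show (4 : ℝ) = 2 ^ 2 by norm_num, log_pow]; norm_num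
  refine log_injOn_pos p2 (half_pos p1) ?_
  rw [log_div p1.ne' two_ne_zero]
  rw [h54] at hkey
  have := pi_pos
  apply mul_left_cancel₀ (show 4 * π ≠ 0 by positivity)
  linarith

/-- The reduced forms `x² + xy + 4y²` and `2x² + xy + 2y²` of discriminant `-15`. -/
def redForm (i : Bool) (x y : ℤ) : ℤ := cond i 1 2 * x ^ 2 + x * y + cond i 4 2 * y ^ 2

/-- The polar form of `redForm`. -/
def redPolar (i : Bool) (x y z w : ℤ) : ℤ :=
  2 * cond i 1 2 * x * z + (x * w + y * z) + 2 * cond i 4 2 * y * w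

theorem redPolar_sq (i : Bool) (x y z w : ℤ) :
    redPolar i x y z w ^ 2 + 15 * (x * w - y * z) ^ 2 = 4 * redForm i x y * redForm i z w := by
  cases i <;> simp only [redPolar, redForm, cond_true, cond_false] <;> ring

theorem redForm_nonneg (i : Bool) (x y : ℤ) : 0 ≤ redForm i x y := by
  cases i <;> simp only [redForm, cond_true, cond_false] <;>
    nlinarith [sq_nonneg (x + y), sq_nonneg x, sq_nonneg y]

theorem exists_redForm_aux (N : ℕ) : ∀ a b c : ℤ, 0 < a → a < N → b ^ 2 + 15 = 4 * a * c →
    ∃ i x y z w, x * w - y * z = 1 ∧ redForm i x y = a ∧ redPolar i x y z w = b := by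
  induction N with
  | zero => intro a b c h1 h2; push_cast at h2; omega
  | succ N ih =>
    intro a b c ha haN h
    set t := -((b + a) / (2 * a)) with ht
    have hdiv := Int.emod_add_mul_ediv (b + a) (2 * a)
    have h0 := Int.emod_nonneg (b + a) (show 2 * a ≠ 0 by omega)
    have h1 := Int.emod_lt_of_pos (b + a) (show 0 < 2 * a by omega)
    set b' := b + 2 * a * t with hb'
    set c' := a * t ^ 2 + b * t + c with hc'
    have hlo : -a ≤ b' := by rw [hb', ht]; linarith
    have hhi : b' ≤ a := by rw [hb', ht]; linarith
    have h' : b' ^ 2 + 15 = 4 * a * c' := by rw [hb', hc']; linear_combination h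
    suffices H : ∃ i x y z w, x * w - y * z = 1 ∧ redForm i x y = a ∧ redPolar i x y z w = b' by
      obtain ⟨i, x, y, z, w, hd, hf, hp⟩ := H
      refine ⟨i, x, y, z - t * x, w - t * y, by linear_combination hd, hf, ?_⟩
      have : redPolar i x y (z - t * x) (w - t * y) =
          redPolar i x y z w - 2 * t * redForm i x y := by
        simp only [redPolar, redForm]; ring
      rw [this, hp, hf, hb']; ring
    have hc0 : 0 < c' := by
      by_contra hc
      nlinarith [sq_nonneg b']
    by_cases hlt : c' < a
    · obtain ⟨i, x, y, z, w, hd, hf, hp⟩ := ih c' (-b') a hc0 (by push_cast at haN; omega)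
        (by linear_combination h')
      have hcol := redPolar_sq i x y z w
      rw [hp, hd, hf] at hcol
      refine ⟨i, z, w, -x, -y, by linear_combination hd, ?_, ?_⟩
      · have : 4 * c' * redForm i z w = 4 * c' * a := by linear_combination -hcol + h'
        exact mul_left_cancel₀ (by positivity) this
      · have : redPolar i z w (-x) (-y) = -redPolar i x y z w := by simp only [redPolar]; ring
        rw [this, hp, neg_neg]
    · have ha2 : a ≤ 2 := by
        by_contra h3
        nlinarith
      have hodd : b' % 2 = 1 := by
        rcases Int.even_or_odd b' with ⟨k, hk⟩ | hk
        · rw [hk] at h'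
          have : 4 * (a * c' - k ^ 2) = 15 := by linear_combination -h'
          omega
        · exact Int.odd_iff.mp hk
      have : a = 1 ∨ a = 2 := by omega
      have hb : b' = 1 ∨ b' = -1 := by omega
      clear_value b' c' t
      rcases this with rfl | rfl <;> rcases hb with rfl | rfl
      · exact ⟨true, 1, 0, 0, 1, by decide⟩
      · exact ⟨true, 1, 0, -1, 1, by decide⟩
      · exact ⟨false, 1, 0, 0, 1, by decide⟩
      · exact ⟨false, 0, 1, -1, 0, by decide⟩

/-- Every positive definite binary form of discriminant `-15` is properly equivalent to one of the
two reduced forms. -/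
theorem exists_redForm {a b c : ℤ} (ha : 0 < a) (h : b ^ 2 + 15 = 4 * a * c) :
    ∃ i x y z w, x * w - y * z = 1 ∧ redForm i x y = a ∧ redPolar i x y z w = b :=
  exists_redForm_aux (a.natAbs + 1) a b c ha (by omega) h

theorem redForm_automorphism {i j : Bool} {a b c d : ℤ} (hdet : a * d - b * c = 1)
    (h1 : redForm j a c = cond i 1 2) (h2 : redPolar j a c b d = 1) :
    i = j ∧ c = 0 ∧ b = 0 ∧ (a = 1 ∨ a = -1) := by
  have hc : c = -1 ∨ c = 0 ∨ c = 1 := by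
    have : -2 < c ∧ c < 2 := by
      constructor <;> cases i <;> cases j <;> simp only [redForm, cond_true, cond_false] at h1 <;>
        nlinarith [sq_nonneg (2 * a + c), sq_nonneg (4 * a + c)]
    omega
  have ha : a = -1 ∨ a = 0 ∨ a = 1 := by
    have : -2 < a ∧ a < 2 := by
      constructor <;> cases i <;> cases j <;> simp only [redForm, cond_true, cond_false] at h1 <;>
        nlinarith [sq_nonneg (a + 8 * c), sq_nonneg (a + 4 * c)]
    omega
  rcases hc with rfl | rfl | rfl <;> rcases ha with rfl | rfl | rfl <;> cases i <;> cases j <;>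
    simp [redForm, redPolar] at h1 h2 hdet ⊢ <;> omega

theorem redForm_unique {i j : Bool} {x y z w x' y' z' w' : ℤ} (hd : x * w - y * z = 1)
    (hd' : x' * w' - y' * z' = 1) (h1 : redForm i x y = redForm j x' y')
    (h2 : redPolar i x y z w = redPolar j x' y' z' w') (hpos : 0 < redForm i x y) :
    i = j ∧ (x' = x ∧ y' = y ∨ x' = -x ∧ y' = -y) := by
  have h3 : redForm i z w = redForm j z' w' := by
    have e1 := redPolar_sq i x y z w
    have e2 := redPolar_sq j x' y' z' w'
    rw [hd] at e1
    rw [hd', ← h1, ← h2] at e2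
    exact mul_left_cancel₀ (show 4 * redForm i x y ≠ 0 by positivity) (e1.symm.trans e2)
  have k1 : redForm j (x' * w - z' * y) (y' * w - w' * y) = cond i 1 2 := by
    have e1 : redForm j (x' * w - z' * y) (y' * w - w' * y) =
        w ^ 2 * redForm j x' y' - w * y * redPolar j x' y' z' w' + y ^ 2 * redForm j z' w' := by
      simp only [redForm, redPolar]; ring
    have e2 : w ^ 2 * redForm i x y - w * y * redPolar i x y z w + y ^ 2 * redForm i z w =
        cond i 1 2 * (x * w - y * z) ^ 2 := by
      simp only [redForm, redPolar]; ring
    rw [e1, ← h1, ← h2, ← h3, e2, hd]; ring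
  have k2 : redPolar j (x' * w - z' * y) (y' * w - w' * y) (z' * x - x' * z)
      (w' * x - y' * z) = 1 := by
    have e1 : redPolar j (x' * w - z' * y) (y' * w - w' * y) (z' * x - x' * z) (w' * x - y' * z) =
        -2 * w * z * redForm j x' y' + (w * x + y * z) * redPolar j x' y' z' w' -
          2 * x * y * redForm j z' w' := by
      simp only [redForm, redPolar]; ring
    have e2 : -2 * w * z * redForm i x y + (w * x + y * z) * redPolar i x y z w -
          2 * x * y * redForm i z w = (x * w - y * z) ^ 2 := by
      simp only [redForm, redPolar]; ring
    rw [e1, ← h1, ← h2, ← h3, e2, hd]; ring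
  obtain ⟨hij, hc, hb, ha⟩ := redForm_automorphism (i := i) (j := j)
    (a := x' * w - z' * y) (b := z' * x - x' * z) (c := y' * w - w' * y) (d := w' * x - y' * z)
    (by linear_combination (x' * w' - y' * z') * hd + hd') k1 k2
  have hx : x' = (x' * w - z' * y) * x + (z' * x - x' * z) * y := by linear_combination -x' * hd
  have hy : y' = (y' * w - w' * y) * x + (w' * x - y' * z) * y := by linear_combination -y' * hd
  have hdd : (x' * w - z' * y) * (w' * x - y' * z) = 1 := by
    have : (x' * w - z' * y) * (w' * x - y' * z) - (z' * x - x' * z) * (y' * w - w' * y) = 1 := by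
      linear_combination (x' * w' - y' * z') * hd + hd'
    rwa [hb, zero_mul, sub_zero] at this
  refine ⟨hij, ?_⟩
  rw [hb] at hx
  rw [hc] at hy
  rcases ha with ha | ha <;> rw [ha] at hx hdd
  · left; exact ⟨by linarith, by rw [hy]; linear_combination y * hdd⟩
  · right; exact ⟨by linarith, by rw [hy]; linear_combination -y * hdd⟩

/-- The set of primitive representations of `n` by the reduced forms of discriminant `-15`. -/
abbrev PrimRep (n : ℕ) : Type :=
  {p : Bool × ℤ × ℤ // IsCoprime p.2.1 p.2.2 ∧ redForm p.1 p.2.1 p.2.2 = n}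

/-- The roots of `k² + k + 4` modulo `n`. -/
abbrev QuadRoot (n : ℕ) : Type := {k : ZMod n // k ^ 2 + k + 4 = 0}

theorem PrimRep.exists_root {n : ℕ} (p : PrimRep n) : ∃ k z w : ℤ,
    p.1.2.1 * w - p.1.2.2 * z = 1 ∧ redPolar p.1.1 p.1.2.1 p.1.2.2 z w = 2 * k + 1 := by
  obtain ⟨⟨i, x, y⟩, ⟨u, v, huv⟩, hn⟩ := p
  have hd : x * u - y * (-v) = 1 := by linear_combination huv
  have h := redPolar_sq i x y (-v) u
  rcases Int.even_or_odd' (redPolar i x y (-v) u) with ⟨k, hk | hk⟩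
  · rw [hk, hd] at h
    have : 4 * (redForm i x y * redForm i (-v) u - k ^ 2) = 15 := by linear_combination -h
    omega
  · exact ⟨k, -v, u, hd, hk⟩

theorem quadRoot_of_redPolar {n : ℕ} {i : Bool} {x y z w k : ℤ} (hd : x * w - y * z = 1)
    (hn : redForm i x y = n) (hk : redPolar i x y z w = 2 * k + 1) :
    (k : ZMod n) ^ 2 + k + 4 = 0 := by
  have h := redPolar_sq i x y z w
  rw [hd, hn, hk] at h
  have : k ^ 2 + k + 4 = n * redForm i z w := by
    apply mul_left_cancel₀ (four_ne_zero' ℤ)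
    linear_combination h
  have := congrArg (Int.cast : ℤ → ZMod n) this
  push_cast at this
  simpa using this

/-- The root of `k² + k + 4` modulo `n` attached to a primitive representation of `n`. -/
noncomputable def PrimRep.root {n : ℕ} (p : PrimRep n) : QuadRoot n :=
  ⟨(p.exists_root.choose : ZMod n), by
    obtain ⟨z, w, hd, hk⟩ := p.exists_root.choose_spec
    exact quadRoot_of_redPolar hd p.2.2 hk⟩

theorem PrimRep.root_eq_iff {n : ℕ} (p : PrimRep n) (k : ℤ) : (p.root : ZMod n) = k ↔
    ∃ z w : ℤ, p.1.2.1 * w - p.1.2.2 * z = 1 ∧ redPolar p.1.1 p.1.2.1 p.1.2.2 z w = 2 * k + 1 := by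
  obtain ⟨z, w, hd, hk⟩ := p.exists_root.choose_spec
  change ((p.exists_root.choose : ℤ) : ZMod n) = k ↔ _
  generalize p.exists_root.choose = l at *
  obtain ⟨⟨i, x, y⟩, hco, hn⟩ := p
  simp only at *
  have hshift : ∀ t : ℤ, redPolar i x y (z + t * x) (w + t * y) =
      redPolar i x y z w + 2 * t * redForm i x y := fun t ↦ by
    simp only [redPolar, redForm]; ring
  constructor
  · intro h
    obtain ⟨t, ht⟩ := (ZMod.intCast_eq_intCast_iff_dvd_sub l k n).mp h
    refine ⟨z + t * x, w + t * y, by linear_combination hd, ?_⟩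
    rw [hshift, hk, hn]
    linear_combination -2 * ht
  · rintro ⟨z', w', hd', hk'⟩
    have hz : z' = z + (w' * z - z' * w) * (-x) := by linear_combination (-z') * hd + z * hd'
    have hw : w' = w + (w' * z - z' * w) * (-y) := by linear_combination (-w') * hd + w * hd'
    have := hshift (-(w' * z - z' * w))
    rw [show z + -(w' * z - z' * w) * x = z' by linear_combination -hz,
      show w + -(w' * z - z' * w) * y = w' by linear_combination -hw, hk, hk', hn] at this
    rw [ZMod.intCast_eq_intCast_iff_dvd_sub]
    exact ⟨-(w' * z - z' * w), by linarith⟩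

theorem card_root_fiber {n : ℕ} (hn : 0 < n) (κ : QuadRoot n) :
    Nat.card {p : PrimRep n // p.root = κ} = 2 := by
  obtain ⟨k, hk⟩ := ZMod.intCast_surjective κ.1
  have hκ := κ.2
  rw [← hk] at hκ
  have hdvd : (n : ℤ) ∣ k ^ 2 + k + 4 := by
    rw [← ZMod.intCast_zmod_eq_zero_iff_dvd]; push_cast; exact hκ
  obtain ⟨c, hc⟩ := hdvd
  obtain ⟨i, x, y, z, w, hd, hf, hp⟩ := exists_redForm (a := n) (b := 2 * k + 1) (c := c)
    (by exact_mod_cast hn) (by linear_combination 4 * hc)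
  have hroot : ∀ p : PrimRep n, p.root = κ ↔ ∃ z w : ℤ, p.1.2.1 * w - p.1.2.2 * z = 1 ∧
      redPolar p.1.1 p.1.2.1 p.1.2.2 z w = 2 * k + 1 := fun p ↦ by
    rw [← PrimRep.root_eq_iff, hk, Subtype.ext_iff]
  have hco : IsCoprime x y := ⟨w, -z, by linear_combination hd⟩
  have hneg : redForm i (-x) (-y) = n := by rw [← hf]; simp only [redForm]; ring
  rw [Nat.card_eq_two_iff]
  refine ⟨⟨⟨(i, x, y), hco, hf⟩, (hroot _).mpr ⟨z, w, hd, hp⟩⟩,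
    ⟨⟨(i, -x, -y), hco.neg_neg, hneg⟩,
      (hroot _).mpr ⟨-z, -w, by linear_combination hd, ?_⟩⟩, ?_, ?_⟩
  · rw [← hp]; simp only [redPolar]; ring
  · intro h
    simp only [Subtype.mk.injEq, Prod.mk.injEq, true_and] at h
    have hx : x = 0 := by omega
    have hy : y = 0 := by omega
    rw [hx, hy] at hd
    omega
  · refine eq_univ_of_forall ?_
    rintro ⟨⟨⟨j, x', y'⟩, hco', hf'⟩, hr⟩
    obtain ⟨z', w', hd', hp'⟩ := (hroot _).mp hr
    simp only at hd' hp' hf'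
    obtain ⟨rfl, ⟨rfl, rfl⟩ | ⟨rfl, rfl⟩⟩ := redForm_unique hd hd' (hf.trans hf'.symm)
      (hp.trans hp'.symm) (by rw [hf]; exact_mod_cast hn)
    · exact Or.inl rfl
    · exact Or.inr rfl

theorem card_primRep {n : ℕ} (hn : 0 < n) : Nat.card (PrimRep n) = 2 * Nat.card (QuadRoot n) := by
  have : NeZero n := ⟨hn.ne'⟩
  have hfin : ∀ κ : QuadRoot n, Finite {p : PrimRep n // p.root = κ} := fun κ ↦
    Nat.finite_of_card_ne_zero (by rw [card_root_fiber hn]; norm_num)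
  rw [← Nat.card_congr (Equiv.sigmaFiberEquiv (PrimRep.root (n := n))), Nat.card_sigma]
  simp_rw [card_root_fiber hn]
  simp [Nat.card_eq_fintype_card, mul_comm]

/-- The summands of the Epstein zeta functions of the reduced forms. -/
noncomputable def redTerm (s : ℝ) (p : Bool × ℤ × ℤ) : ℝ := (redForm p.1 p.2.1 p.2.2 : ℝ) ^ (-s)

theorem redTerm_nonneg (s : ℝ) (p : Bool × ℤ × ℤ) : 0 ≤ redTerm s p :=
  rpow_nonneg (by exact_mod_cast redForm_nonneg ..) _

theorem redForm_true (p : ℤ × ℤ) : redForm true p.1 p.2 = qf 1 1 4 p := by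
  simp only [redForm, qf, cond_true]; ring

theorem redForm_false (p : ℤ × ℤ) : redForm false p.1 p.2 = qf 2 1 2 p := by
  simp only [redForm, qf, cond_false]; ring

theorem summable_redTerm {s : ℝ} (hs : 1 < s) : Summable (redTerm s) := by
  rw [summable_prod_of_nonneg (redTerm_nonneg s)]
  refine ⟨fun i ↦ ?_, (hasSum_fintype _).summable⟩
  cases i
  · simpa only [redTerm, redForm_false] using summable_qf_two_one_two hs
  · simpa only [redTerm, redForm_true] using summable_qf_one_one_four hs

theorem tsum_redTerm {s : ℝ} (hs : 1 < s) :
    ∑' p, redTerm s p = epsteinZeta 2 1 2 s + epsteinZeta 1 1 4 s := by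
  rw [(summable_redTerm hs).tsum_prod, tsum_bool]
  simp only [redTerm, redForm_false, redForm_true, epsteinZeta]

theorem tsum_redTerm_eq_mul {s : ℝ} (hs : 1 < s) : ∑' p, redTerm s p =
    (∑' d : ℕ, ((d : ℝ) + 1) ^ (-(2 * s))) *
      ∑' p : {p : Bool × ℤ × ℤ // IsCoprime p.2.1 p.2.2}, redTerm s p := by
  let g : ℕ × {p : Bool × ℤ × ℤ // IsCoprime p.2.1 p.2.2} → Bool × ℤ × ℤ := fun q ↦
    (q.2.1.1, (q.1 + 1) * q.2.1.2.1, (q.1 + 1) * q.2.1.2.2)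
  have hg : Function.Injective g := by
    rintro ⟨d, ⟨i, x, y⟩, h⟩ ⟨d', ⟨i', x', y'⟩, h'⟩ he
    simp only [g, Prod.mk.injEq] at he
    obtain ⟨rfl, hx, hy⟩ := he
    have hd : d = d' := by
      have h1 : Int.gcd ((d + 1) * x) ((d + 1) * y) = d + 1 := by
        rw [Int.gcd_mul_left, Int.isCoprime_iff_gcd_eq_one.mp h]; omega
      have h2 : Int.gcd ((d' + 1) * x') ((d' + 1) * y') = d' + 1 := by
        rw [Int.gcd_mul_left, Int.isCoprime_iff_gcd_eq_one.mp h']; omega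
      rw [hx, hy, h2] at h1
      omega
    subst hd
    obtain rfl := mul_left_cancel₀ (by omega) hx
    obtain rfl := mul_left_cancel₀ (by omega) hy
    rfl
  have hgs : Function.support (redTerm s) ⊆ range g := by
    rintro ⟨i, x, y⟩ hne
    have h0 : 0 < Int.gcd x y := by
      rw [Nat.pos_iff_ne_zero, Ne, Int.gcd_eq_zero_iff]
      rintro ⟨rfl, rfl⟩
      apply hne
      simp [redTerm, redForm, zero_rpow (show -s ≠ 0 by linarith)]
    obtain ⟨x', y', hco, hx, hy⟩ := Int.exists_gcd_one h0
    obtain ⟨d, hd⟩ := Nat.exists_eq_succ_of_ne_zero h0.ne'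
    refine ⟨⟨d, ⟨(i, x', y'), Int.isCoprime_iff_gcd_eq_one.mpr hco⟩⟩, ?_⟩
    simp only [g, Prod.mk.injEq, true_and]
    rw [hd] at hx hy
    push_cast at hx hy
    exact ⟨by rw [hx, mul_comm], by rw [hy, mul_comm]⟩
  have hterm : ∀ q, redTerm s (g q) = ((q.1 : ℝ) + 1) ^ (-(2 * s)) * redTerm s q.2 := by
    rintro ⟨d, ⟨i, x, y⟩, h⟩
    have e : redForm i ((d + 1) * x) ((d + 1) * y) = (d + 1) ^ 2 * redForm i x y := by
      simp only [redForm]; ring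
    simp only [redTerm, g, e]
    push_cast
    rw [mul_rpow (by positivity) (by exact_mod_cast redForm_nonneg ..), ← rpow_natCast,
      ← rpow_mul (by positivity)]
    congr 2
    push_cast; ring
  rw [← hg.tsum_eq hgs, tsum_congr hterm]
  have hsum : Summable fun q : ℕ × {p : Bool × ℤ × ℤ // IsCoprime p.2.1 p.2.2} ↦
      ((q.1 : ℝ) + 1) ^ (-(2 * s)) * redTerm s q.2 := by
    simpa only [Function.comp_def, hterm] using (summable_redTerm hs).comp_injective hg
  rw [hsum.tsum_prod]
  simp_rw [tsum_mul_left]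
  rw [tsum_mul_right]

theorem hasSum_quadRoot {s : ℝ} (hs : 1 < s) :
    HasSum (fun n : ℕ ↦ 2 * ((Nat.card (QuadRoot n) : ℝ) * (n : ℝ) ^ (-s)))
      (∑' p : {p : Bool × ℤ × ℤ // IsCoprime p.2.1 p.2.2}, redTerm s p) := by
  let g : {p : Bool × ℤ × ℤ // IsCoprime p.2.1 p.2.2} → ℕ := fun p ↦
    (redForm p.1.1 p.1.2.1 p.1.2.2).toNat
  have hS : Summable fun p : {p : Bool × ℤ × ℤ // IsCoprime p.2.1 p.2.2} ↦ redTerm s p :=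
    (summable_redTerm hs).comp_injective Subtype.val_injective
  have hS' := (Equiv.sigmaFiberEquiv g).summable_iff.mpr hS
  have hsum := hS'.hasSum.sigma fun n ↦ (hS'.sigma_factor n).hasSum
  have htot := (Equiv.sigmaFiberEquiv g).tsum_eq fun p ↦ redTerm s p.1
  rw [← htot]
  suffices h : (fun n : ℕ ↦ 2 * ((Nat.card (QuadRoot n) : ℝ) * (n : ℝ) ^ (-s))) = _ from h ▸ hsum
  funext n
  have hg : ∀ p, (redForm p.1.1 p.1.2.1 p.1.2.2 : ℤ) = g p := fun p ↦
    (Int.toNat_of_nonneg (redForm_nonneg ..)).symm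
  have hval : ∀ p : {p // g p = n}, redTerm s p.1 = (n : ℝ) ^ (-s) := fun p ↦ by
    rw [redTerm, hg, p.2]; simp
  simp only [Function.comp_apply, Equiv.sigmaFiberEquiv_apply]
  symm
  rw [tsum_congr hval, tsum_const, nsmul_eq_mul]
  rcases Nat.eq_zero_or_pos n with rfl | hn
  · simp [zero_rpow (show -s ≠ 0 by linarith)]
  · have e : {p // g p = n} ≃ PrimRep n :=
      (Equiv.subtypeSubtypeEquivSubtypeInter _ fun p : Bool × ℤ × ℤ ↦
        (redForm p.1 p.2.1 p.2.2).toNat = n).trans (Equiv.subtypeEquivRight fun p ↦ by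
          have := redForm_nonneg p.1 p.2.1 p.2.2
          rw [and_congr_right_iff]; intro; omega)
    rw [Nat.card_congr e, card_primRep hn]
    push_cast
    ring

/-- The values of the odd quadratic character modulo `15`. -/
def quadCharFun15 : ZMod 15 → ℤ := ![0, 1, 1, 0, 1, 0, 0, -1, 1, 0, 0, -1, 0, -1, -1]

/-- The odd quadratic character modulo `15`, taking values in `ℤ`. -/
def quadChar15 : MulChar (ZMod 15) ℤ where
  toFun := quadCharFun15
  map_one' := rfl
  map_mul' := by decide
  map_nonunit' := by decide

theorem quadChar15_eq_jacobiSym (n : ℤ) : quadChar15 n = jacobiSym n 15 := by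
  have h : ∀ k : ℕ, k < 15 → quadChar15 (k : ZMod 15) = jacobiSym k 15 := by
    intro k hk
    have h3 : quadChar15 (k : ZMod 15) = quadCharFun15 k := rfl
    rw [h3]
    interval_cases k <;> norm_num <;> rfl
  have h2 := h (n : ZMod 15).val (ZMod.val_lt _)
  rw [ZMod.natCast_zmod_val, ZMod.val_intCast] at h2
  rw [h2, ← Nat.cast_ofNat, ← jacobiSym.mod_left]

theorem quadChar15_prime {p : ℕ} (hp : p.Prime) (h2 : p ≠ 2) :
    quadChar15 p = jacobiSym (-15) p := by
  have hodd : Odd p := hp.odd_of_ne_two h2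
  have h1 : quadChar15 (p : ZMod 15) = jacobiSym p 15 := by
    rw [← quadChar15_eq_jacobiSym]; norm_cast
  rw [h1, show (-15 : ℤ) = -(15 : ℕ) by norm_num, jacobiSym.neg _ hodd,
    jacobiSym.quadratic_reciprocity (a := 15) (by decide) hodd]
  rcases Nat.odd_mod_four_iff.mp (Nat.odd_iff.mp hodd) with h | h
  · rw [ZMod.χ₄_nat_one_mod_four h, Even.neg_one_pow ⟨p / 4 * 7, by omega⟩]; simp
  · rw [ZMod.χ₄_nat_three_mod_four h, Odd.neg_one_pow ⟨p / 4 * 7 + 3, by omega⟩]; simp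

theorem quadChar15_sq (k : ZMod 15) (h : quadChar15 k ≠ 0) : quadChar15 k ^ 2 = 1 := by
  revert k; decide

theorem card_quadRoot_zero : Nat.card (QuadRoot 0) = 0 := by
  have aux (k : ℤ) : k ^ 2 + k + 4 ≠ 0 := fun h ↦ by nlinarith [sq_nonneg (2 * k + 1)]
  have : IsEmpty (QuadRoot 0) := ⟨fun k ↦ aux k.1 k.2⟩
  exact Nat.card_of_isEmpty

theorem card_quadRoot_one : Nat.card (QuadRoot 1) = 1 := by
  have : Unique (QuadRoot 1) := ⟨⟨⟨0, Subsingleton.elim _ _⟩⟩, fun _ ↦ Subsingleton.elim _ _⟩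
  exact Nat.card_unique

theorem card_quadRoot_mul {m n : ℕ} (h : m.Coprime n) :
    Nat.card (QuadRoot (m * n)) = Nat.card (QuadRoot m) * Nat.card (QuadRoot n) := by
  rw [← Nat.card_prod]
  let e := ZMod.chineseRemainder h
  have key : ∀ k, k ^ 2 + k + 4 = 0 ↔
      (e k).1 ^ 2 + (e k).1 + 4 = 0 ∧ (e k).2 ^ 2 + (e k).2 + 4 = 0 := by
    intro k
    rw [← e.map_eq_zero_iff, Prod.ext_iff]
    simp only [map_add, map_pow, map_ofNat, Prod.fst_add, Prod.snd_add, Prod.pow_fst, Prod.pow_snd]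
    rfl
  exact Nat.card_congr ((e.toEquiv.subtypeEquiv (q := fun k : ZMod m × ZMod n ↦
    k.1 ^ 2 + k.1 + 4 = 0 ∧ k.2 ^ 2 + k.2 + 4 = 0) key).trans
    (Equiv.subtypeProdEquivProd (p := fun k : ZMod m ↦ k ^ 2 + k + 4 = 0)
      (q := fun k : ZMod n ↦ k ^ 2 + k + 4 = 0)))

theorem card_quadRoot_prime {p : ℕ} (hp : p.Prime) :
    (Nat.card (QuadRoot p) : ℤ) = quadChar15 p + 1 := by
  have := Fact.mk hp
  by_cases h2 : p = 2
  · subst h2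
    rw [Nat.card_eq_fintype_card]
    decide
  · rw [quadChar15_prime hp h2, ← jacobiSym.legendreSym.to_jacobiSym, ← legendreSym.card_sqrts p h2,
      Set.toFinset_card, ← Nat.card_eq_fintype_card]
    have hu : (2 : ZMod p) ≠ 0 := by
      intro h
      have := (ZMod.natCast_eq_zero_iff 2 p).mp (by exact_mod_cast h)
      exact h2 ((Nat.prime_dvd_prime_iff_eq hp Nat.prime_two).mp this)
    congr 1
    refine Nat.card_congr ⟨fun k ↦ ⟨2 * k + 1, ?_⟩, fun x ↦ ⟨(x - 1) / 2, ?_⟩,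
      fun k ↦ ?_, fun x ↦ ?_⟩
    · have := k.2
      push_cast
      simp only [Set.mem_ofPred_eq]
      linear_combination 4 * this
    · have hx : (x : ZMod p) ^ 2 = _ := x.2
      push_cast at hx
      field_simp
      linear_combination hx
    · ext; simp; field_simp
    · ext; simp; field_simp; ring

theorem intCast_quadRoot_iff (n : ℕ) (k : ℤ) :
    (k : ZMod n) ^ 2 + k + 4 = 0 ↔ (n : ℤ) ∣ k ^ 2 + k + 4 := by
  rw [← ZMod.intCast_zmod_eq_zero_iff_dvd]
  push_cast
  rfl

theorem quadRoot_lift_dvd {p e : ℕ} (hp : p.Prime) (h15 : ¬ p ∣ 15) {k l : ℤ}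
    (hk : (p : ℤ) ^ (e + 2) ∣ k ^ 2 + k + 4) (hl : (p : ℤ) ^ (e + 2) ∣ l ^ 2 + l + 4)
    (h : (p : ℤ) ^ (e + 1) ∣ k - l) : (p : ℤ) ^ (e + 2) ∣ k - l := by
  have hpp : Prime (p : ℤ) := Nat.prime_iff_prime_int.mp hp
  have hco : IsCoprime ((p : ℤ) ^ (e + 2)) (k + l + 1) := by
    refine IsCoprime.pow_left ((Prime.coprime_iff_not_dvd hpp).mpr fun hd ↦ h15 ?_)
    have h1 : (p : ℤ) ∣ k - l := (dvd_pow_self _ (by omega)).trans h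
    have h2 : (p : ℤ) ∣ k ^ 2 + k + 4 := (dvd_pow_self _ (by omega)).trans hk
    have h3 : (p : ℤ) ∣ (2 * k + 1) := by
      have := dvd_add h1 hd
      rwa [show k - l + (k + l + 1) = 2 * k + 1 by ring] at this
    have h4 : (p : ℤ) ∣ 15 := by
      have := dvd_sub (h2.mul_left 4) (h3.mul_right (2 * k + 1))
      rwa [show 4 * (k ^ 2 + k + 4) - (2 * k + 1) * (2 * k + 1) = 15 by ring] at this
    exact_mod_cast h4
  refine hco.dvd_of_dvd_mul_right ?_
  have := dvd_sub hk hl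
  rwa [show k ^ 2 + k + 4 - (l ^ 2 + l + 4) = (k - l) * (k + l + 1) by ring] at this

theorem exists_quadRoot_lift {p e : ℕ} (hp : p.Prime) (h15 : ¬ p ∣ 15) {k : ℤ}
    (hk : (p : ℤ) ^ (e + 1) ∣ k ^ 2 + k + 4) :
    ∃ l : ℤ, (p : ℤ) ^ (e + 2) ∣ l ^ 2 + l + 4 ∧ (p : ℤ) ^ (e + 1) ∣ l - k := by
  have hpp : Prime (p : ℤ) := Nat.prime_iff_prime_int.mp hp
  have hco : IsCoprime (p : ℤ) (2 * k + 1) := by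
    refine (Prime.coprime_iff_not_dvd hpp).mpr fun hd ↦ h15 ?_
    have h2 : (p : ℤ) ∣ k ^ 2 + k + 4 := (dvd_pow_self _ (by omega)).trans hk
    have h4 : (p : ℤ) ∣ 15 := by
      have := dvd_sub (h2.mul_left 4) (hd.mul_right (2 * k + 1))
      rwa [show 4 * (k ^ 2 + k + 4) - (2 * k + 1) * (2 * k + 1) = 15 by ring] at this
    exact_mod_cast h4
  obtain ⟨v, u, huv⟩ := hco
  obtain ⟨m, hm⟩ := hk
  refine ⟨k + (-m * u) * p ^ (e + 1), ⟨m * v + m ^ 2 * u ^ 2 * p ^ e, ?_⟩, ⟨-m * u, by ring⟩⟩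
  linear_combination hm - (p : ℤ) ^ (e + 1) * m * huv

theorem card_quadRoot_pow_succ {p : ℕ} (hp : p.Prime) (h15 : ¬ p ∣ 15) (e : ℕ) :
    Nat.card (QuadRoot (p ^ (e + 2))) = Nat.card (QuadRoot (p ^ (e + 1))) := by
  let φ := ZMod.castHom (pow_dvd_pow p (show e + 1 ≤ e + 2 by omega)) (ZMod (p ^ (e + 1)))
  let f : QuadRoot (p ^ (e + 2)) → QuadRoot (p ^ (e + 1)) := fun k ↦ ⟨φ k, by
    have := congrArg φ k.2
    rwa [map_add, map_add, map_pow, map_ofNat, map_zero] at this⟩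
  have hf : Function.Bijective f := by
    constructor
    · rintro ⟨k, hk⟩ ⟨l, hl⟩ h
      obtain ⟨k, rfl⟩ := ZMod.intCast_surjective k
      obtain ⟨l, rfl⟩ := ZMod.intCast_surjective l
      have h' : φ k = φ l := congrArg Subtype.val h
      rw [map_intCast, map_intCast, eq_comm, ZMod.intCast_eq_intCast_iff_dvd_sub] at h'
      rw [intCast_quadRoot_iff] at hk hl
      refine Subtype.ext ?_
      change (k : ZMod (p ^ (e + 2))) = (l : ZMod (p ^ (e + 2)))
      rw [eq_comm, ZMod.intCast_eq_intCast_iff_dvd_sub]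
      push_cast at *
      exact quadRoot_lift_dvd hp h15 hk hl h'
    · rintro ⟨k, hk⟩
      obtain ⟨k, rfl⟩ := ZMod.intCast_surjective k
      rw [intCast_quadRoot_iff] at hk
      push_cast at hk
      obtain ⟨l, hl, hd⟩ := exists_quadRoot_lift hp h15 hk
      refine ⟨⟨(l : ZMod (p ^ (e + 2))),
        (intCast_quadRoot_iff _ _).mpr (by push_cast; exact hl)⟩, Subtype.ext ?_⟩
      change φ l = k
      rw [map_intCast, eq_comm, ZMod.intCast_eq_intCast_iff_dvd_sub]
      push_cast
      exact hd
  exact Nat.card_congr (Equiv.ofBijective f hf)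

theorem card_quadRoot_prime_pow {p : ℕ} (hp : p.Prime) (h15 : ¬ p ∣ 15) (e : ℕ) :
    (Nat.card (QuadRoot (p ^ (e + 1))) : ℤ) = quadChar15 p + 1 := by
  induction e with
  | zero => rw [zero_add, pow_one, card_quadRoot_prime hp]
  | succ e ih => rw [card_quadRoot_pow_succ hp h15, ih]

theorem card_quadRoot_eq_zero_of_dvd {m n : ℕ} (hmn : m ∣ n)
    (h : ∀ k : ZMod m, k ^ 2 + k + 4 ≠ 0) : Nat.card (QuadRoot n) = 0 := by
  have : IsEmpty (QuadRoot n) := ⟨fun k ↦ h (ZMod.castHom hmn (ZMod m) k) (by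
    have := congrArg (ZMod.castHom hmn (ZMod m)) k.2
    rwa [map_add, map_add, map_pow, map_ofNat, map_zero] at this)⟩
  exact Nat.card_of_isEmpty

theorem card_quadRoot_ramified_pow {p : ℕ} (hp : p = 3 ∨ p = 5) (e : ℕ) :
    Nat.card (QuadRoot (p ^ (e + 2))) = 0 := by
  refine card_quadRoot_eq_zero_of_dvd (pow_dvd_pow p (show 2 ≤ e + 2 by omega)) ?_
  rcases hp with rfl | rfl
  · change ∀ k : ZMod 9, _; decide
  · change ∀ k : ZMod 25, _; decide

theorem quadChar15_ne_zero {p : ℕ} (hp : p.Prime) (h15 : ¬ p ∣ 15) :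
    quadChar15 p ≠ 0 := by
  have hu : IsUnit (p : ZMod 15) := (ZMod.isUnit_iff_coprime p 15).mpr
    ((Nat.Prime.coprime_iff_not_dvd hp).mpr h15)
  exact (hu.map quadChar15).ne_zero

/-- The odd quadratic character modulo `15`. -/
noncomputable def dirichletChar15 : DirichletCharacter ℂ 15 :=
  quadChar15.ringHomComp (Int.castRingHom ℂ)

theorem dirichletChar15_apply (k : ZMod 15) : dirichletChar15 k = (quadChar15 k : ℂ) := rfl

/-- The local factor at `p` of the Dirichlet series counting roots of `k² + k + 4`. -/
theorem tsum_card_quadRoot_prime_pow {p : ℕ} (hp : p.Prime) {x : ℂ} (hx : ‖x‖ < 1) :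
    (∑' e : ℕ, (Nat.card (QuadRoot (p ^ e)) : ℂ) * x ^ e) * (1 - x ^ 2)⁻¹ =
      (1 - x)⁻¹ * (1 - dirichletChar15 p * x)⁻¹ := by
  have hx1 : 1 - x ≠ 0 := fun h ↦ by
    rw [← sub_eq_zero.mp h] at hx; simp at hx
  have hx2 : 1 + x ≠ 0 := fun h ↦ by
    rw [← neg_eq_of_add_eq_zero_right h] at hx; simp at hx
  have hx3 : 1 - x ^ 2 ≠ 0 := by
    rw [show 1 - x ^ 2 = (1 - x) * (1 + x) by ring]; exact mul_ne_zero hx1 hx2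
  by_cases h15 : p ∣ 15
  · have hp' : p = 3 ∨ p = 5 := by
      rw [show 15 = 3 * 5 from rfl, hp.dvd_mul] at h15
      exact h15.imp (Nat.prime_dvd_prime_iff_eq hp Nat.prime_three).mp
        (Nat.prime_dvd_prime_iff_eq hp Nat.prime_five).mp
    have hchar : quadChar15 p = 0 := by rcases hp' with rfl | rfl <;> decide
    have h1 : (Nat.card (QuadRoot p) : ℤ) = 1 := by rw [card_quadRoot_prime hp, hchar]; rfl
    have h1' : Nat.card (QuadRoot p) = 1 := by exact_mod_cast h1
    rw [tsum_eq_sum (s := Finset.range 2), Finset.sum_range_succ, Finset.sum_range_one,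
      pow_one, pow_zero, h1', card_quadRoot_one, dirichletChar15_apply, hchar]
    · simp only [Nat.cast_one, Int.cast_zero]
      field_simp
      ring
    · intro e he
      obtain ⟨e, rfl⟩ : ∃ f, e = f + 2 := ⟨e - 2, by simp at he; omega⟩
      rw [card_quadRoot_ramified_pow hp']; simp
  · rw [dirichletChar15_apply]
    set c := (quadChar15 p : ℂ) with hc
    have hc2 : c ^ 2 = 1 := by
      rw [hc]; exact_mod_cast quadChar15_sq _ (quadChar15_ne_zero hp h15)
    have hcn : ‖c‖ = 1 := by
      have := congrArg norm hc2
      rw [norm_pow, norm_one] at this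
      exact (pow_eq_one_iff_of_nonneg (norm_nonneg _) two_ne_zero).mp this
    have hx4 : 1 - c * x ≠ 0 := fun h ↦ by
      have : ‖c * x‖ = 1 := by rw [← sub_eq_zero.mp h, norm_one]
      rw [norm_mul, hcn, one_mul] at this
      exact hx.ne this
    have hs : HasSum (fun e : ℕ ↦ (Nat.card (QuadRoot (p ^ e)) : ℂ) * x ^ e)
        ((c + 1) * (1 - x)⁻¹ - c) := by
      refine (((hasSum_geometric_of_norm_lt_one hx).mul_left (c + 1)).sub
        (hasSum_ite_eq 0 c)).congr_fun fun e ↦ ?_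
      cases e with
      | zero => rw [pow_zero, card_quadRoot_one]; simp
      | succ e =>
        have := card_quadRoot_prime_pow hp h15 e
        rw [hc, if_neg (by omega), sub_zero, ← Int.cast_natCast, this]; push_cast; rfl
    rw [hs.tsum_eq]
    field_simp
    linear_combination -x ^ 2 * hc2

theorem natCast_cpow_two_mul (n : ℕ) (s : ℝ) :
    (n : ℂ) ^ (-(2 * s : ℂ)) = ((n : ℂ) ^ (-(s : ℂ))) ^ 2 := by
  rw [← Complex.cpow_mul_nat]; congr 1; push_cast; ring

theorem tsum_card_quadRoot_mul_riemannZeta {s : ℝ} (hs : 1 < s)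
    (hsum : Summable fun n : ℕ ↦ (Nat.card (QuadRoot n) : ℝ) * (n : ℝ) ^ (-s)) :
    ((∑' n : ℕ, (Nat.card (QuadRoot n) : ℝ) * (n : ℝ) ^ (-s) : ℝ) : ℂ) * riemannZeta (2 * s) =
      riemannZeta s * dirichletChar15.LFunction s := by
  have hs' : 1 < (s : ℂ).re := by simpa using hs
  have hs2 : 1 < (2 * s : ℂ).re := by simp; linarith
  let f : ℕ → ℂ := fun n ↦ (Nat.card (QuadRoot n) : ℂ) * (n : ℂ) ^ (-(s : ℂ))
  have hf : ∀ n : ℕ, f n = ((Nat.card (QuadRoot n) * (n : ℝ) ^ (-s) : ℝ) : ℂ) := fun n ↦ by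
    rw [Complex.ofReal_mul, Complex.ofReal_cpow (Nat.cast_nonneg n)]; push_cast; rfl
  have hpow : ∀ (p e : ℕ),
      ((p ^ e : ℕ) : ℂ) ^ (-(s : ℂ)) = ((p : ℂ) ^ (-(s : ℂ))) ^ e := fun p e ↦ by
    induction e with
    | zero => simp
    | succ e ih => rw [pow_succ, pow_succ, Nat.cast_mul, Complex.natCast_mul_natCast_cpow, ih]
  have hR : HasProd (fun p : Nat.Primes ↦ ∑' e, f (p ^ e)) (∑' n, f n) := by
    refine EulerProduct.eulerProduct_hasProd ?_ ?_ ?_ ?_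
    · simp only [f, card_quadRoot_one, Nat.cast_one, Complex.one_cpow, mul_one]
    · intro m n hmn
      simp only [f, card_quadRoot_mul hmn, Nat.cast_mul, Complex.natCast_mul_natCast_cpow]
      ring
    · refine hsum.congr fun n ↦ ?_
      rw [hf, Complex.norm_real, Real.norm_of_nonneg (by positivity)]
    · simp [f, card_quadRoot_zero]
  have hL := DirichletCharacter.LSeries_eulerProduct_hasProd dirichletChar15 hs'
  rw [← DirichletCharacter.LFunction_eq_LSeries _ hs'] at hL
  have h1 := hR.mul (riemannZeta_eulerProduct_hasProd hs2)
  have h2 := (riemannZeta_eulerProduct_hasProd hs').mul hL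
  have hfs : ((∑' n : ℕ, (Nat.card (QuadRoot n) : ℝ) * (n : ℝ) ^ (-s) : ℝ) : ℂ) = ∑' n, f n := by
    rw [Complex.ofReal_tsum]; exact tsum_congr fun n ↦ (hf n).symm
  rw [hfs]
  refine h1.unique (h2.congr_fun ?_)
  intro p
  have hx : ‖((p : ℕ) : ℂ) ^ (-(s : ℂ))‖ < 1 := by
    rw [Complex.norm_natCast_cpow_of_pos p.2.pos]
    exact Real.rpow_lt_one_of_one_lt_of_neg (by exact_mod_cast p.2.one_lt) (by simp; linarith)
  rw [← tsum_card_quadRoot_prime_pow p.2 hx, natCast_cpow_two_mul]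
  simp only [f, hpow]

theorem epsteinZeta_add_eq {s : ℝ} (hs : 1 < s) :
    ((epsteinZeta 2 1 2 s + epsteinZeta 1 1 4 s : ℝ) : ℂ) =
      2 * (riemannZeta s * dirichletChar15.LFunction s) := by
  have h := hasSum_quadRoot hs
  have h' : Summable fun n : ℕ ↦ (Nat.card (QuadRoot n) : ℝ) * (n : ℝ) ^ (-s) :=
    (summable_mul_left_iff (two_ne_zero' ℝ)).mp h.summable
  rw [← tsum_redTerm hs, tsum_redTerm_eq_mul hs, ← h.tsum_eq, tsum_mul_left,
    ← tsum_card_quadRoot_mul_riemannZeta hs h']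
  have := ofReal_tsum_rpow_eq_riemannZeta (s := 2 * s) (by linarith)
  push_cast at this ⊢
  rw [← this]
  ring

/-- The error of linear interpolation of `t ↦ (n + 1 + t) ^ (-s)` on the unit interval. -/
noncomputable def cpowInterp (x : ℝ) (n : ℕ) (s : ℂ) : ℂ :=
  (n + 1 + x : ℂ) ^ (-s) - (1 - x) * (n + 1 : ℂ) ^ (-s) - x * (n + 2 : ℂ) ^ (-s)

/-- A bounded convex neighbourhood of `0` meeting the half-plane of absolute convergence. -/
def interpDomain : Set ℂ := {s | -(1 / 2) < s.re} ∩ Metric.ball 0 3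

theorem isOpen_interpDomain : IsOpen interpDomain :=
  (isOpen_lt continuous_const Complex.continuous_re).inter Metric.isOpen_ball

theorem convex_interpDomain : Convex ℝ interpDomain :=
  (convex_halfSpace_re_gt _).inter (convex_ball _ _)

theorem zero_mem_interpDomain : (0 : ℂ) ∈ interpDomain := by
  simp [interpDomain]

theorem hasDerivAt_ofReal_add_cpow {a t : ℝ} (h : 0 < a + t) (s : ℂ) :
    HasDerivAt (fun u : ℝ ↦ ((a + u : ℝ) : ℂ) ^ s) (s * ((a + t : ℝ) : ℂ) ^ (s - 1)) t := by
  have h1 : HasDerivAt (fun u : ℝ ↦ ((a + u : ℝ) : ℂ)) 1 t := by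
    have := (((hasDerivAt_id t).const_add a).ofReal_comp)
    simpa using this
  have h2 : ((a + t : ℝ) : ℂ) ∈ Complex.slitPlane := Complex.ofReal_mem_slitPlane.mpr h
  have := (hasDerivAt_id ((a + t : ℝ) : ℂ)).cpow_const (c := s) h2
  have h3 := this.comp t h1
  simp only [id, mul_one] at h3
  exact h3

/-- The error of linear interpolation is controlled by the second derivative. -/
theorem norm_interp_le {g g' g'' : ℝ → ℂ} {M : ℝ}
    (h1 : ∀ t ∈ Icc (0 : ℝ) 1, HasDerivAt g (g' t) t)
    (h2 : ∀ t ∈ Icc (0 : ℝ) 1, HasDerivAt g' (g'' t) t)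
    (hM : ∀ t ∈ Icc (0 : ℝ) 1, ‖g'' t‖ ≤ M) {x : ℝ} (hx : x ∈ Icc (0 : ℝ) 1) :
    ‖g x - (1 - x) * g 0 - x * g 1‖ ≤ 2 * M := by
  have h0 : (0 : ℝ) ∈ Icc (0 : ℝ) 1 := ⟨le_rfl, zero_le_one⟩
  have h1' : (1 : ℝ) ∈ Icc (0 : ℝ) 1 := ⟨zero_le_one, le_rfl⟩
  have hM0 : 0 ≤ M := (norm_nonneg _).trans (hM 0 h0)
  have hg' : ∀ t ∈ Icc (0 : ℝ) 1, ‖g' t - g' 0‖ ≤ M := fun t ht ↦ by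
    have := (convex_Icc (0 : ℝ) 1).norm_image_sub_le_of_norm_hasDerivWithin_le
      (fun t ht ↦ (h2 t ht).hasDerivWithinAt) hM h0 ht
    refine this.trans ?_
    rw [sub_zero, Real.norm_of_nonneg ht.1]
    exact mul_le_of_le_one_right hM0 ht.2
  have hd : ∀ t ∈ Icc (0 : ℝ) 1, HasDerivAt (fun t : ℝ ↦ g t - t * g' 0) (g' t - g' 0) t :=
    fun t ht ↦ by
      have := ((hasDerivAt_id t).ofReal_comp.mul_const (g' 0))
      exact ((h1 t ht).sub this).congr_deriv (by simp)
  have hh : ∀ t ∈ Icc (0 : ℝ) 1, ‖(g t - t * g' 0) - (g 0 - (0 : ℝ) * g' 0)‖ ≤ M := fun t ht ↦ by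
    have := (convex_Icc (0 : ℝ) 1).norm_image_sub_le_of_norm_hasDerivWithin_le
      (fun t ht ↦ (hd t ht).hasDerivWithinAt) hg' h0 ht
    refine this.trans ?_
    rw [sub_zero, Real.norm_of_nonneg ht.1]
    exact mul_le_of_le_one_right hM0 ht.2
  have h3 := hh x hx
  have h4 := hh 1 h1'
  calc ‖g x - (1 - x) * g 0 - x * g 1‖
      = ‖((g x - x * g' 0) - (g 0 - (0 : ℝ) * g' 0)) -
          x * ((g 1 - (1 : ℝ) * g' 0) - (g 0 - (0 : ℝ) * g' 0))‖ := by
        congr 1; push_cast; ring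
    _ ≤ M + 1 * M := by
        refine (norm_sub_le _ _).trans (add_le_add h3 ?_)
        rw [norm_mul, Complex.norm_real, Real.norm_of_nonneg hx.1]
        exact mul_le_mul hx.2 h4 (norm_nonneg _) zero_le_one
    _ = 2 * M := by ring

theorem norm_cpowInterp_le {x : ℝ} (hx : x ∈ Icc (0 : ℝ) 1) (n : ℕ) {s : ℂ}
    (hs : s ∈ interpDomain) : ‖cpowInterp x n s‖ ≤ 24 * ((n : ℝ) + 1) ^ (-(3 / 2) : ℝ) := by
  obtain ⟨hre, hball⟩ := hs
  have hre' : -(1 / 2) < s.re := hre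
  have hns : ‖s‖ < 3 := by simpa using hball
  have hpos : ∀ t ∈ Icc (0 : ℝ) 1, 0 < (n + 1 : ℝ) + t := fun t ht ↦ by
    have := ht.1; positivity
  have key := norm_interp_le (g := fun t : ℝ ↦ ((n + 1 + t : ℝ) : ℂ) ^ (-s))
    (g' := fun t : ℝ ↦ -s * ((n + 1 + t : ℝ) : ℂ) ^ (-s - 1))
    (g'' := fun t : ℝ ↦ -s * ((-s - 1) * ((n + 1 + t : ℝ) : ℂ) ^ (-s - 1 - 1)))
    (M := 12 * ((n : ℝ) + 1) ^ (-(3 / 2) : ℝ))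
    (fun t ht ↦ hasDerivAt_ofReal_add_cpow (hpos t ht) _)
    (fun t ht ↦ (hasDerivAt_ofReal_add_cpow (hpos t ht) _).const_mul _) ?_ hx
  · refine le_trans (le_of_eq ?_) (key.trans (le_of_eq (by ring)))
    simp only [cpowInterp]
    push_cast
    congr 4
    · ring_nf
    · ring_nf
  · intro t ht
    rw [norm_mul, norm_mul, norm_neg, Complex.norm_cpow_eq_rpow_re_of_pos (hpos t ht)]
    have h1 : ‖-s - 1‖ ≤ 4 := by
      refine (norm_sub_le _ _).trans ?_
      rw [norm_neg, norm_one]; linarith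
    have h2 : ((n : ℝ) + 1 + t) ^ (-s - 1 - 1).re ≤ ((n : ℝ) + 1) ^ (-(3 / 2) : ℝ) := by
      have hb : (1 : ℝ) ≤ n + 1 + t := by have := ht.1; have := Nat.cast_nonneg (α := ℝ) n; linarith
      calc ((n : ℝ) + 1 + t) ^ (-s - 1 - 1).re ≤ ((n : ℝ) + 1 + t) ^ (-(3 / 2) : ℝ) :=
            Real.rpow_le_rpow_of_exponent_le hb (by simp; linarith)
        _ ≤ _ := Real.rpow_le_rpow_of_nonpos (by positivity) (by linarith [ht.1]) (by norm_num)
    have h3 : 0 ≤ ((n : ℝ) + 1 + t) ^ (-s - 1 - 1).re := Real.rpow_nonneg (hpos t ht).le _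
    calc ‖s‖ * (‖-s - 1‖ * ((n : ℝ) + 1 + t) ^ (-s - 1 - 1).re)
        ≤ 3 * (4 * ((n : ℝ) + 1) ^ (-(3 / 2) : ℝ)) := by gcongr
      _ = _ := by ring

theorem summable_cpowInterp_bound : Summable fun n : ℕ ↦ 24 * ((n : ℝ) + 1) ^ (-(3 / 2) : ℝ) := by
  have := (Real.summable_nat_rpow (p := (-(3 / 2) : ℝ))).mpr (by norm_num)
  have := (summable_nat_add_iff 1).mpr this
  exact (this.congr fun n ↦ by push_cast; rfl).mul_left 24

theorem differentiable_cpowInterp {x : ℝ} (hx : 0 < x) (n : ℕ) :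
    Differentiable ℂ (cpowInterp x n) := by
  have h1 : (n + 1 + x : ℂ) ≠ 0 := by
    have : (0 : ℝ) < n + 1 + x := by positivity
    exact_mod_cast this.ne'
  have h2 : (n + 1 : ℂ) ≠ 0 := by exact_mod_cast (Nat.succ_ne_zero n)
  have h3 : (n + 2 : ℂ) ≠ 0 := by exact_mod_cast (Nat.succ_ne_zero (n + 1))
  exact ((differentiable_neg.const_cpow (Or.inl h1)).sub
    ((differentiable_neg.const_cpow (Or.inl h2)).const_mul _)).sub
    ((differentiable_neg.const_cpow (Or.inl h3)).const_mul _)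

theorem deriv_cpowInterp_zero {x : ℝ} (hx : 0 < x) (n : ℕ) :
    deriv (cpowInterp x n) 0 =
      ((-log (n + 1 + x) + (1 - x) * log (n + 1) + x * log (n + 2) : ℝ) : ℂ) := by
  have key : ∀ c : ℝ, 0 < c → HasDerivAt (fun s : ℂ ↦ (c : ℂ) ^ (-s)) (-(log c : ℝ) : ℂ) 0 := by
    intro c hc
    have := (hasDerivAt_neg' (0 : ℂ)).const_cpow (c := (c : ℂ)) (Or.inl (by exact_mod_cast hc.ne'))
    simpa [Complex.ofReal_log hc.le] using this
  have h1 := key (n + 1 + x) (by positivity)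
  have h2 := key (n + 1) (by positivity)
  have h3 := key (n + 2) (by positivity)
  have h := (h1.sub (h2.const_mul (1 - x : ℂ))).sub (h3.const_mul (x : ℂ))
  have heq : cpowInterp x n = fun s : ℂ ↦ ((n + 1 + x : ℝ) : ℂ) ^ (-s) -
      (1 - x : ℂ) * ((n + 1 : ℝ) : ℂ) ^ (-s) - (x : ℂ) * ((n + 2 : ℝ) : ℂ) ^ (-s) := by
    ext s; simp only [cpowInterp]; push_cast; rfl
  rw [heq]
  refine h.deriv.trans ?_
  push_cast
  ring

theorem differentiableOn_tsum_cpowInterp {x : ℝ} (hx : x ∈ Ioc (0 : ℝ) 1) :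
    DifferentiableOn ℂ (fun s ↦ ∑' n, cpowInterp x n s) interpDomain :=
  Complex.differentiableOn_tsum_of_summable_norm summable_cpowInterp_bound
    (fun n ↦ (differentiable_cpowInterp hx.1 n).differentiableOn) isOpen_interpDomain
    fun n _ hs ↦ norm_cpowInterp_le (Ioc_subset_Icc_self hx) n hs

theorem cpowInterp_zero (x : ℝ) (n : ℕ) : cpowInterp x n 0 = 0 := by
  simp [cpowInterp]

theorem sum_range_deriv_cpowInterp (x : ℝ) (n : ℕ) :
    ∑ k ∈ Finset.range n, (-log (k + 1 + x) + (1 - x) * log (k + 1) + x * log (k + 2)) =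
      BohrMollerup.logGammaSeq x n + log x + x * (log (n + 1) - log n) := by
  have h1 : ∀ n : ℕ, log (n.factorial) = ∑ k ∈ Finset.range n, log ((k : ℝ) + 1) := fun n ↦ by
    induction n with
    | zero => simp
    | succ n ih =>
      rw [Nat.factorial_succ, Finset.sum_range_succ, ← ih]
      push_cast
      rw [Real.log_mul (by positivity) (by positivity), add_comm]
  rw [BohrMollerup.logGammaSeq, Finset.sum_range_succ', h1]
  have h2 : ∑ k ∈ Finset.range n, (log ((k : ℝ) + 2) - log ((k : ℝ) + 1)) = log (n + 1) := by
    have := Finset.sum_range_sub (fun k : ℕ ↦ log ((k : ℝ) + 1)) n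
    simp only [Nat.cast_zero, zero_add, log_one, sub_zero] at this
    rw [← this]
    refine Finset.sum_congr rfl fun k _ ↦ ?_
    push_cast; ring_nf
  have h3 : ∑ k ∈ Finset.range n, log (x + ((k + 1 : ℕ) : ℝ)) =
      ∑ k ∈ Finset.range n, log ((k : ℝ) + 1 + x) :=
    Finset.sum_congr rfl fun k _ ↦ by push_cast; rw [add_comm x]
  have h4 : ∑ k ∈ Finset.range n, (-log (k + 1 + x) + (1 - x) * log (k + 1) + x * log (k + 2)) =
      -(∑ k ∈ Finset.range n, log ((k : ℝ) + 1 + x)) + ∑ k ∈ Finset.range n, log ((k : ℝ) + 1) +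
        x * ∑ k ∈ Finset.range n, (log ((k : ℝ) + 2) - log ((k : ℝ) + 1)) := by
    rw [Finset.mul_sum, ← Finset.sum_neg_distrib, ← Finset.sum_add_distrib,
      ← Finset.sum_add_distrib]
    exact Finset.sum_congr rfl fun k _ ↦ by ring
  rw [h4, h2, h3, Nat.cast_zero, add_zero]
  ring

theorem hasDerivAt_tsum_cpowInterp {x : ℝ} (hx : x ∈ Ioc (0 : ℝ) 1) :
    HasDerivAt (fun s ↦ ∑' n, cpowInterp x n s) ((log (Gamma x) + log x : ℝ) : ℂ) 0 := by
  have hdiff := (differentiableOn_tsum_cpowInterp hx).differentiableAt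
    (isOpen_interpDomain.mem_nhds zero_mem_interpDomain)
  have h := Complex.hasSum_deriv_of_summable_norm summable_cpowInterp_bound
    (fun n ↦ (differentiable_cpowInterp hx.1 n).differentiableOn) isOpen_interpDomain
    (fun n _ hs ↦ norm_cpowInterp_le (Ioc_subset_Icc_self hx) n hs) zero_mem_interpDomain
  convert! hdiff.hasDerivAt using 1
  refine tendsto_nhds_unique ?_ h.tendsto_sum_nat
  simp only [deriv_cpowInterp_zero hx.1]
  have h1 := BohrMollerup.tendsto_log_gamma hx.1
  have h2 : Tendsto (fun n : ℕ ↦ x * (log ((n : ℝ) + 1) - log n)) atTop (𝓝 0) := by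
    simpa using (Real.tendsto_log_nat_add_one_sub_log.const_mul x)
  have h3 := (h1.add_const (log x)).add h2
  rw [add_zero] at h3
  refine ((Complex.continuous_ofReal.tendsto _).comp h3).congr fun n ↦ ?_
  rw [Function.comp_apply, ← sum_range_deriv_cpowInterp, Complex.ofReal_sum]

theorem hurwitzZeta_sub_eq_of_one_lt_re {x : ℝ} (hx : x ∈ Ioc (0 : ℝ) 1) {s : ℂ} (hs : 1 < s.re) :
    HurwitzZeta.hurwitzZeta x s - HurwitzZeta.hurwitzZeta 0 s =
      (x : ℂ) ^ (-s) - x + ∑' n, cpowInterp x n s := by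
  have h1 := HurwitzZeta.hasSum_hurwitzZeta_of_one_lt_re (Ioc_subset_Icc_self hx) hs
  have h2 := HurwitzZeta.hasSum_hurwitzZeta_of_one_lt_re (a := 1) ⟨zero_le_one, le_rfl⟩ hs
  rw [AddCircle.coe_period] at h2
  have h1' := (hasSum_nat_add_iff' 1).mpr h1
  have h2' := (hasSum_nat_add_iff' 1).mpr h2
  have h3 := (h1'.sub (h2.mul_left (1 - x : ℂ))).sub (h2'.mul_left (x : ℂ))
  have h4 : HasSum (fun n ↦ cpowInterp x n s) _ := h3.congr_fun fun n ↦ by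
    simp only [cpowInterp, Complex.cpow_neg, one_div]
    push_cast
    congr 4
    ring
  rw [h4.tsum_eq, Finset.sum_range_one, Finset.sum_range_one]
  simp only [Complex.cpow_neg, Nat.cast_zero, zero_add, one_div, Complex.ofReal_one,
    Complex.one_cpow, inv_one]
  ring

theorem hurwitzZeta_sub_eq {x : ℝ} (hx : x ∈ Ioc (0 : ℝ) 1) :
    EqOn (fun s ↦ HurwitzZeta.hurwitzZeta x s - HurwitzZeta.hurwitzZeta 0 s)
      (fun s ↦ (x : ℂ) ^ (-s) - x + ∑' n, cpowInterp x n s) interpDomain := by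
  have hx0 : (x : ℂ) ≠ 0 := by exact_mod_cast hx.1.ne'
  have h2 : (2 : ℂ) ∈ interpDomain := by
    refine ⟨?_, ?_⟩
    · change -(1 / 2) < (2 : ℂ).re; norm_num
    · simp; norm_num
  have hf : AnalyticOnNhd ℂ (fun s ↦ HurwitzZeta.hurwitzZeta x s - HurwitzZeta.hurwitzZeta 0 s)
      interpDomain :=
    (HurwitzZeta.differentiable_hurwitzZeta_sub_hurwitzZeta _ _).differentiableOn.analyticOnNhd
      isOpen_interpDomain
  have hg : AnalyticOnNhd ℂ (fun s ↦ (x : ℂ) ^ (-s) - x + ∑' n, cpowInterp x n s)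
      interpDomain := by
    refine DifferentiableOn.analyticOnNhd (DifferentiableOn.add ?_
      (differentiableOn_tsum_cpowInterp hx)) isOpen_interpDomain
    exact ((differentiable_neg.const_cpow (Or.inl hx0)).sub_const _).differentiableOn
  refine hf.eqOn_of_preconnected_of_eventuallyEq hg convex_interpDomain.isPreconnected h2 ?_
  have : ∀ᶠ s : ℂ in 𝓝 2, 1 < s.re :=
    Complex.continuous_re.continuousAt.eventually (lt_mem_nhds (by norm_num))
  filter_upwards [this] with s hs
  exact hurwitzZeta_sub_eq_of_one_lt_re hx hs

theorem hurwitzZeta_sub_apply_zero {x : ℝ} (hx : x ∈ Ioc (0 : ℝ) 1) :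
    HurwitzZeta.hurwitzZeta x 0 - HurwitzZeta.hurwitzZeta 0 0 = 1 - x := by
  have := hurwitzZeta_sub_eq hx zero_mem_interpDomain
  simpa [cpowInterp_zero] using this

/-- The Lerch formula for the derivative of the Hurwitz zeta function at `0`. -/
theorem hasDerivAt_hurwitzZeta_sub {x : ℝ} (hx : x ∈ Ioc (0 : ℝ) 1) :
    HasDerivAt (fun s ↦ HurwitzZeta.hurwitzZeta x s - HurwitzZeta.hurwitzZeta 0 s)
      (log (Gamma x) : ℂ) 0 := by
  have hx0 : (x : ℂ) ≠ 0 := by exact_mod_cast hx.1.ne'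
  have h1 := ((hasDerivAt_neg' (0 : ℂ)).const_cpow (c := (x : ℂ)) (Or.inl hx0)).sub_const (x : ℂ)
  have h2 := h1.add (hasDerivAt_tsum_cpowInterp hx)
  refine (h2.congr_of_eventuallyEq ?_).congr_deriv ?_
  · filter_upwards [isOpen_interpDomain.mem_nhds zero_mem_interpDomain] with s hs
    exact hurwitzZeta_sub_eq hx hs
  · rw [← Complex.ofReal_log hx.1.le]
    simp

theorem dirichletChar15_zero : dirichletChar15 0 = 0 := by
  rw [dirichletChar15_apply, show quadChar15 0 = 0 from rfl, Int.cast_zero]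

theorem sum_quadChar15_mul (f : ℕ → ℂ) : ∑ j : ZMod 15, dirichletChar15 j * f j.val =
    f 1 + f 2 + f 4 + f 8 - f 7 - f 11 - f 13 - f 14 := by
  have : ∑ j : ZMod 15, dirichletChar15 j * f j.val =
    ∑ j : Fin 15, (quadCharFun15 j : ℂ) * f j.val := rfl
  rw [this]
  simp [Fin.sum_univ_succ, quadCharFun15]
  ring

theorem dirichletChar15_ne_one : dirichletChar15 ≠ 1 := by
  intro h
  have h1 : dirichletChar15 (-1) = 1 := by rw [h]; exact MulChar.one_apply isUnit_one.neg
  rw [dirichletChar15_apply, show quadChar15 (-1) = -1 from rfl] at h1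
  norm_num at h1

theorem LFunction_dirichletChar15_eq (s : ℂ) : dirichletChar15.LFunction s =
    (15 : ℂ) ^ (-s) * ∑ j : ZMod 15, dirichletChar15 j *
      (HurwitzZeta.hurwitzZeta (((j.val : ℝ) / 15 : ℝ) : UnitAddCircle) s -
        HurwitzZeta.hurwitzZeta 0 s) := by
  simp only [mul_sub, Finset.sum_sub_distrib, ← Finset.sum_mul]
  rw [MulChar.sum_eq_zero_of_ne_one dirichletChar15_ne_one, zero_mul, mul_zero, sub_zero]
  simp only [DirichletCharacter.LFunction, ZMod.LFunction, ZMod.toAddCircle_apply, Nat.cast_ofNat]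

theorem val_div_mem_Ioc {j : ZMod 15} (hj : j ≠ 0) : (j.val : ℝ) / 15 ∈ Ioc (0 : ℝ) 1 := by
  have h1 : 0 < j.val := Nat.pos_of_ne_zero ((ZMod.val_ne_zero j).mpr hj)
  have h2 : j.val < 15 := j.val_lt
  refine ⟨by positivity, ?_⟩
  rw [div_le_one (by norm_num)]
  exact_mod_cast h2.le

theorem LFunction_dirichletChar15_zero : dirichletChar15.LFunction 0 = 2 := by
  have h : ∀ j : ZMod 15, dirichletChar15 j *
      (HurwitzZeta.hurwitzZeta (((j.val : ℝ) / 15 : ℝ) : UnitAddCircle) 0 -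
        HurwitzZeta.hurwitzZeta 0 0) =
      dirichletChar15 j * (fun n : ℕ ↦ (1 - n / 15 : ℂ)) j.val := by
    intro j
    by_cases hj : j = 0
    · rw [hj, dirichletChar15_zero]; simp
    · rw [hurwitzZeta_sub_apply_zero (val_div_mem_Ioc hj)]; push_cast; rfl
  rw [LFunction_dirichletChar15_eq, Finset.sum_congr rfl fun j _ ↦ h j,
    sum_quadChar15_mul fun n : ℕ ↦ (1 - n / 15 : ℂ)]
  norm_num

theorem hasDerivAt_LFunction_dirichletChar15 : HasDerivAt dirichletChar15.LFunction
    (-2 * log 15 + ∑ j : ZMod 15, dirichletChar15 j * (log (Gamma ((j.val : ℝ) / 15)) : ℂ)) 0 := by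
  have h : ∀ j : ZMod 15, HasDerivAt (fun s ↦ dirichletChar15 j *
      (HurwitzZeta.hurwitzZeta (((j.val : ℝ) / 15 : ℝ) : UnitAddCircle) s -
        HurwitzZeta.hurwitzZeta 0 s))
      (dirichletChar15 j * (log (Gamma ((j.val : ℝ) / 15)) : ℂ)) 0 := by
    intro j
    by_cases hj : j = 0
    · rw [hj, dirichletChar15_zero]; simpa using hasDerivAt_const (0 : ℂ) (0 : ℂ)
    · exact (hasDerivAt_hurwitzZeta_sub (val_div_mem_Ioc hj)).const_mul _
  have hsum := HasDerivAt.fun_sum (u := Finset.univ) fun j _ ↦ h j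
  have h15 := (hasDerivAt_neg' (0 : ℂ)).const_cpow (c := (15 : ℂ)) (Or.inl (by norm_num))
  have hval := LFunction_dirichletChar15_zero
  rw [LFunction_dirichletChar15_eq, neg_zero, Complex.cpow_zero, one_mul] at hval
  refine ((h15.mul hsum).congr_of_eventuallyEq
    (.of_forall LFunction_dirichletChar15_eq)).congr_deriv ?_
  rw [hval]
  simp only [neg_zero, Complex.cpow_zero]
  rw [show (15 : ℂ) = ((15 : ℝ) : ℂ) by norm_num, ← Complex.ofReal_log (by norm_num)]
  ring

theorem odd_dirichletChar15 : dirichletChar15.Odd := by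
  change dirichletChar15 (-1) = -1
  rw [dirichletChar15_apply, show quadChar15 (-1) = -1 from rfl]
  norm_num

theorem inv_dirichletChar15 : dirichletChar15⁻¹ = dirichletChar15 := by
  rw [inv_eq_iff_mul_eq_one]
  ext k
  rw [MulChar.mul_apply, MulChar.one_apply_coe, dirichletChar15_apply, ← Int.cast_mul, ← sq,
    quadChar15_sq _ (k.isUnit.map quadChar15).ne_zero, Int.cast_one]

theorem not_factorsThrough_dirichletChar15 {d : ℕ} (hd : d ∣ 15) (u : (ZMod 15)ˣ)
    (h1 : ZMod.castHom hd (ZMod d) u = 1) (h2 : quadChar15 u = -1) :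
    ¬ dirichletChar15.FactorsThrough d := by
  intro h
  have h3 := (DirichletCharacter.factorsThrough_iff_ker_unitsMap hd).mp h
    (x := u) (MonoidHom.mem_ker.mpr (Units.ext h1))
  have h4 := congrArg Units.val (MonoidHom.mem_ker.mp h3)
  rw [MulChar.coe_toUnitHom, dirichletChar15_apply, h2] at h4
  norm_num at h4

theorem isPrimitive_dirichletChar15 : dirichletChar15.IsPrimitive := by
  rw [DirichletCharacter.isPrimitive_def]
  have hf := DirichletCharacter.factorsThrough_conductor dirichletChar15
  have hd := DirichletCharacter.conductor_dvd_level dirichletChar15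
  have h1 : ¬ dirichletChar15.FactorsThrough 3 :=
    not_factorsThrough_dirichletChar15 (by norm_num) ⟨7, 13, rfl, rfl⟩ rfl rfl
  have h2 : ¬ dirichletChar15.FactorsThrough 5 :=
    not_factorsThrough_dirichletChar15 (by norm_num) ⟨11, 11, rfl, rfl⟩ rfl rfl
  have h3 : ¬ dirichletChar15.FactorsThrough 1 := fun h ↦
    h1 (h.mono _ (one_dvd _) (by norm_num))
  have hmem := Nat.mem_divisors.mpr ⟨hd, by norm_num⟩
  generalize dirichletChar15.conductor = c at *
  rw [show Nat.divisors 15 = {1, 3, 5, 15} from rfl] at hmem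
  simp only [Finset.mem_insert, Finset.mem_singleton] at hmem
  rcases hmem with rfl | rfl | rfl | rfl <;> first | rfl | contradiction

theorem LFunction_dirichletChar15_mul_Gammaℝ {s : ℂ} (hs : -1 < s.re) :
    dirichletChar15.LFunction s * Complex.Gammaℝ (s + 1) =
      dirichletChar15.completedLFunction s := by
  rw [DirichletCharacter.LFunction_eq_completed_div_gammaFactor _ _ (Or.inr (by norm_num)),
    odd_dirichletChar15.gammaFactor_def, div_mul_cancel₀]
  exact Complex.Gammaℝ_ne_zero_of_re_pos (by simp; linarith)

theorem LFunction_dirichletChar15_one_sub {s : ℂ} (hs : -1 < s.re) (hs' : s.re < 2) :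
    dirichletChar15.LFunction (1 - s) * Complex.Gammaℝ (2 - s) =
      dirichletChar15.rootNumber * ((15 : ℂ) ^ (s - 1 / 2) *
        (dirichletChar15.LFunction s * Complex.Gammaℝ (s + 1))) := by
  rw [LFunction_dirichletChar15_mul_Gammaℝ hs, show 2 - s = (1 - s) + 1 by ring,
    LFunction_dirichletChar15_mul_Gammaℝ (by simp; linarith),
    isPrimitive_dirichletChar15.completedLFunction_one_sub, inv_dirichletChar15]
  push_cast
  ring

theorem hasDerivAt_Gammaℝ_two :
    HasDerivAt Complex.Gammaℝ (-(log π + eulerMascheroniConstant) / (2 * π) : ℂ) 2 := by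
  have h1 := ((hasDerivAt_neg' (2 : ℂ)).div_const 2).const_cpow (c := π) (Or.inl (by simp))
  have h2 : HasDerivAt (fun s : ℂ ↦ Complex.Gamma (s / 2)) (-eulerMascheroniConstant / 2) 2 := by
    have h : HasDerivAt (fun s : ℂ ↦ s / 2) (1 / 2) 2 := (hasDerivAt_id (2 : ℂ)).div_const 2
    have hg : HasDerivAt Complex.Gamma (-eulerMascheroniConstant : ℂ) (2 / 2 : ℂ) := by
      rw [div_self two_ne_zero]; exact Complex.hasDerivAt_Gamma_one
    exact (HasDerivAt.comp (h := fun s : ℂ ↦ s / 2) 2 hg h).congr_deriv (by ring)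
  have h := h1.mul h2
  rw [show (-2 / 2 : ℂ) = -1 by norm_num, Complex.cpow_neg_one, div_self two_ne_zero,
    Complex.Gamma_one, ← Complex.ofReal_log pi_pos.le] at h
  refine h.congr_deriv ?_
  field_simp
  ring

theorem hasDerivAt_LFunction_dirichletChar15_one {S : ℂ}
    (hS : HasDerivAt dirichletChar15.LFunction (-2 * log 15 + S) 0) :
    HasDerivAt dirichletChar15.LFunction
      (dirichletChar15.LFunction 1 * (eulerMascheroniConstant + log π + log 2 - S / 2)) 1 := by
  have hpi : (π : ℂ) ≠ 0 := by exact_mod_cast pi_ne_zero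
  have hL := (DirichletCharacter.differentiable_LFunction dirichletChar15_ne_one 1).hasDerivAt
  have e1 : HasDerivAt (fun s : ℂ ↦ dirichletChar15.LFunction (1 - s))
      (-deriv dirichletChar15.LFunction 1) 0 := by
    have h : HasDerivAt dirichletChar15.LFunction (deriv dirichletChar15.LFunction 1)
        ((1 : ℂ) - 0) := by simpa using hL
    simpa using h.comp_const_sub 1 0
  have e2 : HasDerivAt (fun s : ℂ ↦ Complex.Gammaℝ (2 - s))
      (-(-(log π + eulerMascheroniConstant) / (2 * π) : ℂ)) 0 := by
    have h : HasDerivAt Complex.Gammaℝ (-(log π + eulerMascheroniConstant) / (2 * π) : ℂ)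
        ((2 : ℂ) - 0) := by simpa using hasDerivAt_Gammaℝ_two
    exact h.comp_const_sub 2 0
  have e3 : HasDerivAt (fun s : ℂ ↦ Complex.Gammaℝ (s + 1))
      (-(eulerMascheroniConstant + Complex.log (4 * π)) / 2 : ℂ) 0 := by
    have h : HasDerivAt Complex.Gammaℝ (-(eulerMascheroniConstant + Complex.log (4 * π)) / 2 : ℂ)
        ((0 : ℂ) + 1) := by simpa using Complex.hasDerivAt_Gammaℝ_one
    exact h.comp_add_const 0 1
  have e4 := ((hasDerivAt_id (0 : ℂ)).sub_const (1 / 2)).const_cpow (c := (15 : ℂ))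
    (Or.inl (by norm_num))
  have hA := e1.mul e2
  have hB := (e4.mul (hS.mul e3)).const_mul dirichletChar15.rootNumber
  have hev : ∀ᶠ s : ℂ in 𝓝 0, -1 < s.re ∧ s.re < 2 :=
    (Complex.continuous_re.continuousAt.eventually (lt_mem_nhds (by norm_num))).and
      (Complex.continuous_re.continuousAt.eventually (gt_mem_nhds (by norm_num)))
  have hAB := hA.unique (hB.congr_of_eventuallyEq (hev.mono fun s hs ↦
    LFunction_dirichletChar15_one_sub hs.1 hs.2))
  have hv := LFunction_dirichletChar15_one_sub (s := 0) (by norm_num) (by norm_num)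
  have hG2 : Complex.Gammaℝ 2 = 1 / π := by
    rw [Complex.Gammaℝ, show (-2 / 2 : ℂ) = -1 by norm_num, Complex.cpow_neg_one,
      div_self two_ne_zero, Complex.Gamma_one, mul_one, one_div]
  have hl4 : Complex.log (4 * π) = 2 * log 2 + log π := by
    rw [show (4 * π : ℂ) = ((4 * π : ℝ) : ℂ) by push_cast; ring,
      ← Complex.ofReal_log (by positivity), Real.log_mul (by norm_num) pi_ne_zero,
      show (4 : ℝ) = 2 ^ 2 by norm_num, Real.log_pow]
    push_cast; ring
  have hl15 : Complex.log 15 = log 15 := by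
    rw [show (15 : ℂ) = ((15 : ℝ) : ℂ) by norm_num, ← Complex.ofReal_log (by norm_num)]
  simp only [id, Pi.mul_apply, sub_zero, zero_add, zero_sub, hG2, hl4, hl15,
    Complex.Gammaℝ_one, mul_one,
    LFunction_dirichletChar15_zero] at hAB hv
  refine hL.congr_deriv ?_
  field_simp at hAB hv ⊢
  linear_combination (-1) * hAB +
    (S - eulerMascheroniConstant - 2 * log 2 - log π : ℂ) * hv

theorem sin_mul_sin_pi_div_fifteen :
    sin (π / 15) * sin (2 * (π / 15)) * sin (4 * (π / 15)) * sin (8 * (π / 15)) = 1 / 16 := by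
  have h1 : 2 * sin (π / 15) * sin (4 * (π / 15)) = cos (π / 5) - cos (π / 3) := by
    rw [show π / 5 = 4 * (π / 15) - π / 15 by ring, show π / 3 = 4 * (π / 15) + π / 15 by ring,
      cos_sub, cos_add]
    ring
  have h2 : 2 * sin (2 * (π / 15)) * sin (8 * (π / 15)) =
      cos (2 * (π / 5)) - cos (2 * (π / 3)) := by
    rw [show 2 * (π / 5) = 8 * (π / 15) - 2 * (π / 15) by ring,
      show 2 * (π / 3) = 8 * (π / 15) + 2 * (π / 15) by ring, cos_sub, cos_add]
    ring
  rw [cos_two_mul, cos_two_mul, cos_pi_div_three, cos_pi_div_five] at h2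
  rw [cos_pi_div_three, cos_pi_div_five] at h1
  have h5 : √5 ^ 2 = 5 := Real.sq_sqrt (by norm_num)
  have h12 := congrArg₂ (· * ·) h1 h2
  linear_combination h12 / 4 + (√5 / 128 + 1 / 128) * h5

theorem log_Gamma_sub_log_Gamma_one_sub {x : ℝ} (h0 : 0 < x) (h1 : x < 1) :
    log (Gamma x) - log (Gamma (1 - x)) = 2 * log (Gamma x) - log π + log (sin (π * x)) := by
  have hs : 0 < sin (π * x) := sin_pos_of_pos_of_lt_pi (by positivity)
    (by nlinarith [pi_pos])
  have h := congrArg log (Real.Gamma_mul_Gamma_one_sub x)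
  rw [Real.log_mul (Gamma_pos_of_pos h0).ne' (Gamma_pos_of_pos (by linarith)).ne',
    Real.log_div pi_ne_zero hs.ne'] at h
  linarith

theorem sum_dirichletChar15_log_Gamma :
    ∑ j : ZMod 15, dirichletChar15 j * (log (Gamma ((j.val : ℝ) / 15)) : ℂ) =
      ((2 * log (Gamma (1 / 15) * Gamma (2 / 15) * Gamma (4 / 15) * Gamma (8 / 15)) -
        4 * log π - 4 * log 2 : ℝ) : ℂ) := by
  rw [sum_quadChar15_mul fun n : ℕ ↦ (log (Gamma ((n : ℝ) / 15)) : ℂ)]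
  have e1 := log_Gamma_sub_log_Gamma_one_sub (x := 1 / 15) (by norm_num) (by norm_num)
  have e2 := log_Gamma_sub_log_Gamma_one_sub (x := 2 / 15) (by norm_num) (by norm_num)
  have e4 := log_Gamma_sub_log_Gamma_one_sub (x := 4 / 15) (by norm_num) (by norm_num)
  have e8 := log_Gamma_sub_log_Gamma_one_sub (x := 8 / 15) (by norm_num) (by norm_num)
  have hs : ∀ k : ℝ, 0 < k → k < 15 → sin (k * (π / 15)) ≠ 0 := fun k hk hk' ↦
    (sin_pos_of_pos_of_lt_pi (by positivity) (by nlinarith [pi_pos])).ne'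
  have hG : ∀ x : ℝ, 0 < x → Gamma x ≠ 0 := fun x hx ↦ (Gamma_pos_of_pos hx).ne'
  have hp := congrArg log sin_mul_sin_pi_div_fifteen
  have hs1 : sin (π / 15) ≠ 0 := by simpa using hs 1 (by norm_num) (by norm_num)
  have hs2 := hs 2 (by norm_num) (by norm_num)
  have hs4 := hs 4 (by norm_num) (by norm_num)
  have hs8 := hs 8 (by norm_num) (by norm_num)
  rw [Real.log_mul (by positivity) hs8, Real.log_mul (by positivity) hs4, Real.log_mul hs1 hs2,
    one_div, Real.log_inv, show (16 : ℝ) = 2 ^ 4 by norm_num, Real.log_pow] at hp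
  have g1 := hG (1 / 15) (by norm_num)
  have g2 := hG (2 / 15) (by norm_num)
  have g4 := hG (4 / 15) (by norm_num)
  have g8 := hG (8 / 15) (by norm_num)
  rw [Real.log_mul (by positivity) g8, Real.log_mul (by positivity) g4, Real.log_mul g1 g2]
  rw [show π * (1 / 15) = π / 15 by ring] at e1
  rw [show π * (2 / 15) = 2 * (π / 15) by ring] at e2
  rw [show π * (4 / 15) = 4 * (π / 15) by ring] at e4
  rw [show π * (8 / 15) = 8 * (π / 15) by ring] at e8
  norm_num at e1 e2 e4 e8 hp
  have key : log (Gamma (1 / 15)) + log (Gamma (2 / 15)) + log (Gamma (4 / 15)) +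
      log (Gamma (8 / 15)) - log (Gamma (7 / 15)) - log (Gamma (11 / 15)) -
      log (Gamma (13 / 15)) - log (Gamma (14 / 15)) =
      2 * (log (Gamma (1 / 15)) + log (Gamma (2 / 15)) + log (Gamma (4 / 15)) +
        log (Gamma (8 / 15))) - 4 * log π - 4 * log 2 := by
    linarith
  exact_mod_cast congrArg Complex.ofReal key

/-- Two evaluations of the constant term at `s = 1` of the completed zeta function of `ℚ(√-15)`. -/
theorem tendsto_completed_zeta_mul_LFunction {S : ℂ}
    (hS : HasDerivAt dirichletChar15.LFunction (-2 * log 15 + S) 0) {C : ℝ}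
    (hC : Tendsto (fun s : ℝ ↦ (√15 / 2) ^ s * (epsteinZeta 2 1 2 s + epsteinZeta 1 1 4 s) -
      2 * π / (s - 1)) (𝓝[>] 1) (𝓝 C)) :
    (C : ℂ) = 2 * π * (2 * eulerMascheroniConstant + log (√15 / 2) + log π + log 2 - S / 2) := by
  set F : ℂ → ℂ := fun s ↦ ((√15 / 2 : ℝ) : ℂ) ^ s * (2 * dirichletChar15.LFunction s) with hF
  have hc : (0 : ℝ) < √15 / 2 := by positivity
  have hdF : HasDerivAt F
      (F 1 * (log (√15 / 2) + (eulerMascheroniConstant + log π + log 2 - S / 2))) 1 := by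
    have h1 := (hasDerivAt_id (1 : ℂ)).const_cpow (c := ((√15 / 2 : ℝ) : ℂ))
      (Or.inl (by exact_mod_cast hc.ne'))
    have h2 := (hasDerivAt_LFunction_dirichletChar15_one hS).const_mul 2
    refine (h1.mul h2).congr_deriv ?_
    rw [← Complex.ofReal_log hc.le]
    simp only [hF, id]
    ring
  have hmap : Tendsto (fun s : ℝ ↦ (s : ℂ)) (𝓝[>] 1) (𝓝[≠] 1) := by
    refine tendsto_nhdsWithin_of_tendsto_nhds_of_eventually_within _ ?_ ?_
    · exact (Complex.continuous_ofReal.tendsto 1).mono_left nhdsWithin_le_nhds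
    · filter_upwards [self_mem_nhdsWithin] with a ha
      exact Complex.ofReal_ne_one.mpr (ne_of_gt ha)
  have hz := tendsto_riemannZeta_sub_one_div.comp hmap
  have hs := (hasDerivAt_iff_tendsto_slope.mp hdF).comp hmap
  have hF1 := (hdF.continuousAt.tendsto.mono_left nhdsWithin_le_nhds).comp hmap
  have hC' := (Complex.continuous_ofReal.tendsto _).comp hC
  have hrest := (hC'.sub (hF1.mul hz)).sub hs
  have hid : Tendsto (fun s : ℝ ↦ (s : ℂ) - 1) (𝓝[>] 1) (𝓝 0) := by
    have := (hmap.mono_right nhdsWithin_le_nhds).sub_const 1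
    simpa using this
  have heq : ∀ᶠ s : ℝ in 𝓝[>] 1, (F 1 - 2 * π) / ((s : ℂ) - 1) =
      ((↑) ∘ fun s : ℝ ↦ (√15 / 2) ^ s * (epsteinZeta 2 1 2 s + epsteinZeta 1 1 4 s) -
      2 * π / (s - 1)) s - (F ∘ fun s : ℝ ↦ (s : ℂ)) s *
      ((fun s : ℂ ↦ riemannZeta s - 1 / (s - 1)) ∘ fun s : ℝ ↦ (s : ℂ)) s -
      (slope F 1 ∘ fun s : ℝ ↦ (s : ℂ)) s := by
    filter_upwards [self_mem_nhdsWithin] with s hs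
    have hs1 : (s : ℂ) - 1 ≠ 0 := by
      rw [sub_ne_zero]; exact_mod_cast (ne_of_gt hs)
    have h := epsteinZeta_add_eq hs
    simp only [Function.comp_apply, slope_def_field]
    rw [Complex.ofReal_sub, Complex.ofReal_mul, h, Complex.ofReal_cpow hc.le]
    push_cast [hF]
    field_simp
    ring
  have hrest' := hrest.congr' (heq.mono fun _ h ↦ h.symm)
  have hF2 : F 1 = 2 * π := by
    have h1 := hrest'.mul hid
    rw [mul_zero] at h1
    have h2 : Tendsto (fun _ : ℝ ↦ F 1 - 2 * π) (𝓝[>] 1) (𝓝 0) := by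
      refine h1.congr' ?_
      filter_upwards [self_mem_nhdsWithin] with s hs
      refine div_mul_cancel₀ _ ?_
      rw [sub_ne_zero]; exact_mod_cast (ne_of_gt hs)
    exact sub_eq_zero.mp (tendsto_nhds_unique tendsto_const_nhds h2)
  rw [hF2] at hrest'
  simp only [sub_self, zero_div] at hrest'
  have := tendsto_nhds_unique tendsto_const_nhds hrest'
  linear_combination -this

theorem norm_dedekindEta_mul_sq : (‖dedekindEta cmPoint‖ * ‖dedekindEta (3 * cmPoint)‖) ^ 2 =
    Gamma (1 / 15) * Gamma (2 / 15) * Gamma (4 / 15) * Gamma (8 / 15) / (40 * √3 * π ^ 3) := by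
  have h0 := hasDerivAt_LFunction_dirichletChar15
  rw [sum_dirichletChar15_log_Gamma] at h0
  have h := tendsto_completed_zeta_mul_LFunction h0 tendsto_epsteinZeta_one_three
  set G := Gamma (1 / 15) * Gamma (2 / 15) * Gamma (4 / 15) * Gamma (8 / 15)
  have hG : 0 < G := by
    have h (x : ℝ) (hx : 0 < x) : 0 < Gamma x := Gamma_pos_of_pos hx
    have := h (1 / 15) (by norm_num)
    have := h (2 / 15) (by norm_num)
    have := h (4 / 15) (by norm_num)
    have := h (8 / 15) (by norm_num)
    positivity
  have hP : 0 < ‖dedekindEta cmPoint‖ * ‖dedekindEta (3 * cmPoint)‖ :=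
    mul_pos (norm_dedekindEta_pos cmPoint) (norm_dedekindEta_pos (nsmulPoint 3 three_pos cmPoint))
  set P := ‖dedekindEta cmPoint‖ * ‖dedekindEta (3 * cmPoint)‖
  have h' : 4 * π * (eulerMascheroniConstant - log 2) - π * log (5 / 4) - 4 * π * log P =
      2 * π * (2 * eulerMascheroniConstant + log (√15 / 2) + log π + log 2 -
        (2 * log G - 4 * log π - 4 * log 2) / 2) := by
    exact_mod_cast h
  clear_value G P
  refine Real.log_injOn_pos (mem_Ioi.mpr (by positivity)) (mem_Ioi.mpr (by positivity)) ?_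
  rw [Real.log_div hG.ne' (by positivity), Real.log_mul (by positivity) (by positivity),
    Real.log_mul (by positivity) (by positivity), Real.log_pow, Real.log_pow,
    Real.log_sqrt (by norm_num), show (40 : ℝ) = 2 ^ 3 * 5 by norm_num,
    Real.log_mul (by norm_num) (by norm_num), Real.log_pow]
  rw [Real.log_div (by norm_num) (by norm_num), Real.log_div (by positivity) (by norm_num),
    Real.log_sqrt (by norm_num), show (4 : ℝ) = 2 ^ 2 by norm_num, Real.log_pow,
    show (15 : ℝ) = 3 * 5 by norm_num, Real.log_mul (by norm_num) (by norm_num)] at h'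
  push_cast at h' ⊢
  refine mul_left_cancel₀ pi_ne_zero ?_
  linear_combination (-1 / 2) * h'

theorem tprod_eq_norm {f : ℕ → ℂ} (hf : ∀ n, f n = ‖f n‖) : ∏' n, f n = ‖∏' n, f n‖ := by
  by_cases h : Multipliable f
  · have hc : IsClosed {z : ℂ | z = ‖z‖} := isClosed_eq continuous_id (by fun_prop)
    refine hc.mem_of_tendsto h.hasProd (.of_forall fun s ↦ ?_)
    change ∏ n ∈ s, f n = ‖∏ n ∈ s, f n‖
    rw [norm_prod, Complex.ofReal_prod]
    exact Finset.prod_congr rfl fun n _ ↦ hf n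
  · simp [tprod_eq_one_of_not_multipliable h]

/-- On the vertical lines with half-integral abscissa the argument of `η` comes from its leading
exponential factor. -/
theorem dedekindEta_eq_exp_mul_norm (z : ℍ) (m : ℤ) (hz : 2 * z.re = m) :
    dedekindEta z = Complex.exp (π * Complex.I * z.re / 12) * ‖dedekindEta z‖ := by
  have hzi : (z : ℂ) = z.re + z.im * Complex.I := (Complex.re_add_im _).symm
  have h2 : (z.re : ℂ) = m / 2 := by
    rw [eq_div_iff two_ne_zero, mul_comm]; exact_mod_cast hz
  have hf : ∀ n : ℕ, (1 - Complex.exp (2 * π * Complex.I * ((n : ℂ) + 1) * z)) =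
      ‖(1 - Complex.exp (2 * π * Complex.I * ((n : ℂ) + 1) * z))‖ := fun n ↦ by
    have h1 : Complex.exp (2 * π * Complex.I * ((n : ℂ) + 1) * z) =
        (((-1) ^ (m * (n + 1)) * exp (-(2 * π * (n + 1) * z.im)) : ℝ) : ℂ) := by
      push_cast
      rw [← Complex.exp_pi_mul_I, ← Complex.exp_int_mul, ← Complex.exp_add, hzi, h2]
      congr 1
      push_cast
      linear_combination (2 * π * (n + 1) * z.im) * Complex.I_sq
    have h3 : |(-1) ^ (m * (n + 1)) * exp (-(2 * π * (n + 1) * z.im))| ≤ 1 := by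
      rw [abs_mul, abs_zpow, abs_neg, abs_one, one_zpow, one_mul, Real.abs_exp, Real.exp_le_one_iff,
        neg_nonpos]
      have := z.im_pos
      positivity
    rw [h1, ← Complex.ofReal_one, ← Complex.ofReal_sub, Complex.norm_real,
      Real.norm_of_nonneg (by linarith [(abs_le.mp h3).2])]
  rw [dedekindEta, tprod_eq_norm hf, norm_mul, Complex.norm_real, norm_norm, Complex.norm_exp]
  push_cast
  rw [← mul_assoc, ← Complex.exp_add]
  congr 2
  have : (π * Complex.I * z / 12 : ℂ).re = -(π * z.im / 12) := by
    rw [hzi]; simp [Complex.div_ofNat_re, neg_div]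
  rw [this, hzi]
  push_cast
  linear_combination (π * z.im / 12) * Complex.I_sq

theorem dedekindEta_natCast_mul_cmPoint {k : ℕ} (hk : 0 < k) :
    dedekindEta (k * cmPoint) =
      Complex.exp (π * Complex.I / 24) ^ k * ‖dedekindEta (k * cmPoint)‖ := by
  have hre : (nsmulPoint k hk cmPoint).re = k / 2 := by
    rw [nsmulPoint_re, cmPoint_re, mul_one_div]
  have h := dedekindEta_eq_exp_mul_norm (nsmulPoint k hk cmPoint) k (by rw [hre]; push_cast; ring)
  rw [hre] at h
  refine h.trans (congrArg₂ _ ?_ rfl)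
  rw [← Complex.exp_nat_mul]
  congr 1
  push_cast
  ring

theorem varpi₂_cmPoint : varpi₂ cmPoint =
    ((4 * (‖dedekindEta cmPoint‖ * ‖dedekindEta (3 * cmPoint)‖) ^ 2 : ℝ) : ℂ) := by
  have e1 := dedekindEta_natCast_mul_cmPoint one_pos
  have e2 := dedekindEta_natCast_mul_cmPoint two_pos
  have e3 := dedekindEta_natCast_mul_cmPoint three_pos
  have e6 := dedekindEta_natCast_mul_cmPoint (k := 6) (by norm_num)
  have hn : (‖dedekindEta (2 * cmPoint)‖ * ‖dedekindEta (6 * cmPoint)‖ : ℂ) =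
      ‖dedekindEta cmPoint‖ * ‖dedekindEta (3 * cmPoint)‖ / 2 := by
    exact_mod_cast norm_dedekindEta_two_mul_six
  have hP : (‖dedekindEta cmPoint‖ * ‖dedekindEta (3 * cmPoint)‖ : ℂ) ≠ 0 := by
    exact_mod_cast (mul_pos (norm_dedekindEta_pos cmPoint)
      (norm_dedekindEta_pos (nsmulPoint 3 three_pos cmPoint))).ne'
  simp only [Nat.cast_one, one_mul, pow_one, Nat.cast_ofNat] at e1 e2 e3 e6
  have hζ := Complex.exp_ne_zero (π * Complex.I / 24)
  generalize Complex.exp (π * Complex.I / 24) = ζ at *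
  rw [varpi₂]
  generalize ‖dedekindEta cmPoint‖ = a at *
  generalize ‖dedekindEta (2 * cmPoint)‖ = b at *
  generalize ‖dedekindEta (3 * cmPoint)‖ = c at *
  generalize ‖dedekindEta (6 * cmPoint)‖ = d at *
  rw [e1, e2, e3, e6]
  calc (ζ * a * (ζ ^ 3 * c)) ^ 4 / (ζ ^ 2 * b * (ζ ^ 6 * d)) ^ 2
      = (ζ ^ 16 * ((a : ℂ) * c) ^ 4) / (ζ ^ 16 * ((b : ℂ) * d) ^ 2) := by ring
    _ = ((4 * (a * c) ^ 2 : ℝ) : ℂ) := by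
      rw [hn]
      push_cast
      field_simp
      norm_num

end

theorem varpi₂_value :
    varpi₂ ((3 + Real.sqrt 15 * Complex.I) / 6) =
      ((Real.Gamma (1 / 15) * Real.Gamma (2 / 15) * Real.Gamma (4 / 15) * Real.Gamma (8 / 15) /
          (10 * Real.sqrt 3 * Real.pi ^ 3) : ℝ) : ℂ) := by
  refine varpi₂_cmPoint.trans ?_
  rw [norm_dedekindEta_mul_sq]
  congr 1
  field_simp
  norm_num
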